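/- arXiv:math/9804074 — 2 statements merged into one kernel-verified Lean document; each statement's English description precedes it below -/
import Mathlib

section
/- Let A be a unital C*-algebra and E a conditional expectation on A. If there is a real number K ≥ 1 such that the map K·E − id_A is positive, then for every real number L with L ≥ K·⌊K⌋ (where ⌊K⌋ denotes the integer part of K), the map L·E − id_A is completely positive. -/
variable {A : Type*} [CStarAlgebra A] [PartialOrder A] [StarOrderedRing A]

/-- A conditional expectation on a unital C*-algebra `A`: a linear, idempotent, unital,
positive, contractive (norm-one, since `E 1 = 1`) map whose range is a C*-subalgebra
`B = E(A)` (closed under multiplication and star) and which is a `B`-bimodule map. -/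
structure IsCondExp (E : A → A) : Prop where
  map_add : ∀ a b : A, E (a + b) = E a + E b
  map_smul : ∀ (c : ℂ) (a : A), E (c • a) = c • E a
  idem : ∀ a : A, E (E a) = E a
  map_one : E 1 = 1
  pos : ∀ a : A, 0 ≤ a → 0 ≤ E a
  contractive : ∀ a : A, ‖E a‖ ≤ ‖a‖
  range_mul : ∀ a b : A, E (E a * E b) = E a * E b
  range_star : ∀ a : A, E (star (E a)) = star (E a)
  bimod : ∀ a b c : A, E (E b * a * E c) = E b * E a * E c

/-- A map `Φ` on a (C*-)algebra `R` is completely positive if for every `n ≥ 1` its entrywise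
application to `n × n` matrices over `R` maps positive elements (i.e. elements of the form
`star B * B`, which are exactly the positive elements of the C*-algebra of matrices over a
C*-algebra) to positive elements. -/
def IsCompletelyPositive {R : Type*} [Ring R] [StarRing R] (Φ : R → R) : Prop :=
  ∀ (n : ℕ) (M : Matrix (Fin n) (Fin n) R),
    (∃ B : Matrix (Fin n) (Fin n) R, M = star B * B) →
    ∃ C : Matrix (Fin n) (Fin n) R, M.map Φ = star C * C

section PositiveDomination
open scoped InnerProductSpace ComplexOrder

section GNS

namespace PositiveLinearMap

variable (f : A →ₚ[ℂ] ℂ)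

/-- The canonical cyclic vector of the GNS representation. -/
noncomputable def gnsVec : f.GNS := (f.toPreGNS 1 : f.PreGNS)

lemma gns_apply_gnsVec (a : A) :
    f.gnsStarAlgHom a f.gnsVec = (f.toPreGNS a : f.PreGNS) := by
  rw [gnsVec, gnsStarAlgHom_apply]
  simp

lemma inner_gns_apply_gnsVec (a b : A) :
    ⟪f.gnsStarAlgHom a f.gnsVec, f.gnsStarAlgHom b f.gnsVec⟫_ℂ = f (star a * b) := by
  rw [gns_apply_gnsVec, gns_apply_gnsVec, UniformSpace.Completion.inner_coe, preGNS_inner_def]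
  simp

lemma denseRange_gns : DenseRange fun a => f.gnsStarAlgHom a f.gnsVec := by
  have := (UniformSpace.Completion.denseRange_coe (α := f.PreGNS))
  refine this.mono ?_
  rintro _ ⟨x, rfl⟩
  exact ⟨f.ofPreGNS x, f.gns_apply_gnsVec _⟩

lemma inner_gnsVec_apply (a : A) : ⟪f.gnsVec, f.gnsStarAlgHom a f.gnsVec⟫_ℂ = f a := by
  simpa using f.inner_gns_apply_gnsVec 1 a

lemma norm_gnsVec_sq : ‖f.gnsVec‖ ^ 2 = (f 1).re := by
  have := f.inner_gnsVec_apply 1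
  rw [map_one, one_apply_eq_self, inner_self_eq_norm_sq_to_K] at this
  rw [← this]; norm_cast

lemma norm_apply_le_re (a : A) : ‖f a‖ ≤ (f 1).re * ‖a‖ := by
  rw [← inner_gnsVec_apply, ← norm_gnsVec_sq]
  calc _ ≤ ‖f.gnsVec‖ * ‖f.gnsStarAlgHom a f.gnsVec‖ := norm_inner_le_norm _ _
    _ ≤ ‖f.gnsVec‖ * (‖a‖ * ‖f.gnsVec‖) := by
      gcongr
      refine (ContinuousLinearMap.le_opNorm _ _).trans ?_
      gcongr
      exact NonUnitalStarAlgHom.norm_apply_le f.gnsStarAlgHom a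
    _ = _ := by ring

variable {H : Type*} [NormedAddCommGroup H] [InnerProductSpace ℂ H] [CompleteSpace H]
  (π : A →⋆ₐ[ℂ] (H →L[ℂ] H))

/-- A vector whose functional is dominated by a multiple of `f` induces an operator out of the
GNS space of `f`. -/
lemma exists_gns_intertwiner {K : ℝ} (z : H)
    (hz : ∀ a, ‖π a z‖ ^ 2 ≤ K * (f (star a * a)).re) :
    ∃ T : f.GNS →L[ℂ] H, ∀ a, T (f.gnsStarAlgHom a f.gnsVec) = π a z := by
  let g : f.PreGNS →ₗ[ℂ] H :=
    { toFun := fun x => π (f.ofPreGNS x) z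
      map_add' := by simp
      map_smul' := by simp }
  let e : f.PreGNS →L[ℂ] f.GNS := UniformSpace.Completion.toComplL
  have hd : DenseRange e := UniformSpace.Completion.denseRange_coe
  have hb : ∃ C, ∀ x, ‖g x‖ ≤ C * ‖e x‖ := by
    refine ⟨√K, fun x => ?_⟩
    have h1 : ‖e x‖ = √(f (star (f.ofPreGNS x) * f.ofPreGNS x)).re := by
      rw [← preGNS_norm_def]; exact UniformSpace.Completion.norm_coe _
    have h0 : 0 ≤ (f (star (f.ofPreGNS x) * f.ofPreGNS x)).re :=
      (Complex.le_def.1 (f.map_nonneg (star_mul_self_nonneg _))).1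
    rw [h1, ← Real.sqrt_mul' _ h0]
    exact Real.le_sqrt_of_sq_le (hz _)
  refine ⟨g.extendOfNorm (e : f.PreGNS →ₗ[ℂ] f.GNS), fun a => ?_⟩
  rw [gns_apply_gnsVec]
  exact LinearMap.extendOfNorm_eq (f := g) (e := (e : f.PreGNS →ₗ[ℂ] f.GNS)) hd hb _

lemma gns_intertwiner_apply {T : f.GNS →L[ℂ] H} {z : H}
    (hT : ∀ a, T (f.gnsStarAlgHom a f.gnsVec) = π a z) (a : A) (x : f.GNS) :
    T (f.gnsStarAlgHom a x) = π a (T x) := by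
  suffices h : (fun x => T (f.gnsStarAlgHom a x)) = fun x => π a (T x) from congrFun h x
  refine f.denseRange_gns.equalizer (by fun_prop) (by fun_prop) ?_
  ext b
  simp only [Function.comp]
  rw [hT, ← mul_apply_eq_comp, ← mul_apply_eq_comp, ← map_mul, ← map_mul,
    hT]

lemma gns_intertwiner_adjoint_apply {T : f.GNS →L[ℂ] H} {z : H}
    (hT : ∀ a, T (f.gnsStarAlgHom a f.gnsVec) = π a z) (a : A) (y : H) :
    (ContinuousLinearMap.adjoint T) (π a y) =
      f.gnsStarAlgHom a ((ContinuousLinearMap.adjoint T) y) := by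
  refine ext_inner_right ℂ fun x => ?_
  have h1 : π a = ContinuousLinearMap.adjoint (π (star a)) := by
    rw [map_star, ContinuousLinearMap.star_eq_adjoint, ContinuousLinearMap.adjoint_adjoint]
  have h2 : f.gnsStarAlgHom a = ContinuousLinearMap.adjoint (f.gnsStarAlgHom (star a)) := by
    rw [map_star, ContinuousLinearMap.star_eq_adjoint, ContinuousLinearMap.adjoint_adjoint]
  rw [ContinuousLinearMap.adjoint_inner_left, h1, h2, ContinuousLinearMap.adjoint_inner_left,
    ContinuousLinearMap.adjoint_inner_left, ContinuousLinearMap.adjoint_inner_left,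
    gns_intertwiner_apply f π hT]

end PositiveLinearMap
end GNS

section PureState

/-- The state space of a unital C*-algebra, with the topology of pointwise convergence. -/
def stateSpace (A : Type*) [CStarAlgebra A] [PartialOrder A] [StarOrderedRing A] :
    Set (A → ℂ) :=
  {φ | φ 1 = 1 ∧ ∃ f : A →ₚ[ℂ] ℂ, ⇑f = φ}

lemma mem_stateSpace_iff {φ : A → ℂ} :
    φ ∈ stateSpace A ↔ φ 1 = 1 ∧ (∀ a b, φ (a + b) = φ a + φ b) ∧
      (∀ (c : ℂ) a, φ (c • a) = c * φ a) ∧ ∀ a, 0 ≤ a → 0 ≤ φ a := by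
  refine and_congr_right fun _ => ⟨?_, fun ⟨h1, h2, h3⟩ => ?_⟩
  · rintro ⟨f, rfl⟩
    exact ⟨map_add f, fun c a => by simp, fun a ha => f.map_nonneg ha⟩
  · exact ⟨PositiveLinearMap.mk₀ { toFun := φ, map_add' := h1, map_smul' := h2 } h3, rfl⟩

lemma isCompact_stateSpace : IsCompact (stateSpace A) := by
  refine (isCompact_univ_pi fun a : A =>
    isCompact_closedBall (0 : ℂ) ‖a‖).of_isClosed_subset ?_ ?_
  · have : stateSpace A = {φ : A → ℂ | φ 1 = 1 ∧ (∀ a b, φ (a + b) = φ a + φ b) ∧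
        (∀ (c : ℂ) a, φ (c • a) = c * φ a) ∧ ∀ a, 0 ≤ a → 0 ≤ φ a} :=
      Set.ext fun φ => mem_stateSpace_iff
    rw [this]
    simp only [Set.ofPred_and, Set.ofPred_forall]
    refine (isClosed_eq (by fun_prop) (by fun_prop)).inter ((isClosed_iInter fun a =>
      isClosed_iInter fun b => isClosed_eq (by fun_prop) (by fun_prop)).inter
      ((isClosed_iInter fun c => isClosed_iInter fun a =>
        isClosed_eq (by fun_prop) (by fun_prop)).inter
      (isClosed_iInter fun a => isClosed_iInter fun _ =>
        isClosed_le (by fun_prop) (by fun_prop))))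
  · rintro _ ⟨h1, f, rfl⟩ a -
    simpa [h1] using f.norm_apply_le_re a

lemma convex_stateSpace : Convex ℝ (stateSpace A) := by
  intro φ hφ ψ hψ s t hs ht hst
  rw [mem_stateSpace_iff] at *
  obtain ⟨h1, h2, h3, h4⟩ := hφ
  obtain ⟨h1', h2', h3', h4'⟩ := hψ
  refine ⟨?_, fun a b => ?_, fun c a => ?_, fun a ha => ?_⟩
  · simp only [Pi.add_apply, Pi.smul_apply, h1, h1']
    rw [← add_smul, hst, one_smul]
  · simp only [Pi.add_apply, Pi.smul_apply, h2, h2', smul_add]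
    abel
  · simp only [Pi.add_apply, Pi.smul_apply, h3, h3', Complex.real_smul]
    ring
  · exact add_nonneg (smul_nonneg hs (h4 a ha)) (smul_nonneg ht (h4' a ha))

lemma smul_mem_stateSpace (f : A →ₚ[ℂ] ℂ) {c : ℝ} (hc : 0 ≤ c) (h1 : c • f 1 = 1) :
    c • ⇑f ∈ stateSpace A :=
  mem_stateSpace_iff.2 ⟨h1, fun a b => by simp, fun z a => by simp; ring,
    fun a ha => smul_nonneg hc (f.map_nonneg ha)⟩

lemma exists_state_neg {y : A} (hy : IsSelfAdjoint y) (hy0 : ¬ 0 ≤ y) :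
    ∃ φ ∈ stateSpace A, (φ y).re < 0 := by
  obtain ⟨g, hg, hgy⟩ := (ProperCone.positive ℝ A).hyperplane_separation_point (x₀ := y) hy0
  let g' : A →ₗ[ℂ] ℂ :=
    { toFun := fun a => (g (realPart a : A) : ℂ) + Complex.I * (g (imaginaryPart a : A) : ℂ)
      map_add' := fun a b => by simp; ring
      map_smul' := fun c a => by
        simp [realPart_smul, imaginaryPart_smul]
        apply Complex.ext <;> simp }
  have hsa : ∀ a, IsSelfAdjoint a → g' a = g a := fun a ha => by
    simp [g', ha.coe_realPart, ha.imaginaryPart]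
  let f : A →ₚ[ℂ] ℂ := PositiveLinearMap.mk₀ g' fun a ha => by
    rw [hsa a ha.isSelfAdjoint]
    exact_mod_cast hg a ha
  have hfy : f y = g y := hsa y hy
  have h1 : 0 < (f 1).re := by
    by_contra! h
    have := (f.norm_apply_le_re y).trans (mul_nonpos_of_nonpos_of_nonneg h (norm_nonneg y))
    have : f y = 0 := by simpa using this
    rw [hfy] at this
    have : g y = 0 := by exact_mod_cast this
    linarith
  have hf1 : f 1 = ((f 1).re : ℂ) := by
    rw [show f 1 = g 1 from hsa 1 (.one A)]; simp
  refine ⟨((f 1).re)⁻¹ • ⇑f, smul_mem_stateSpace f (inv_nonneg.2 h1.le) ?_, ?_⟩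
  · rw [hf1]; simp [h1.ne']
  · rw [Pi.smul_apply, hfy, Complex.real_smul, ← Complex.ofReal_mul, Complex.ofReal_re]
    exact mul_neg_of_pos_of_neg (inv_pos.2 h1) hgy

lemma exists_extreme_state_neg {y : A} (hy : IsSelfAdjoint y) (hy0 : ¬ 0 ≤ y) :
    ∃ φ ∈ (stateSpace A).extremePoints ℝ, (φ y).re < 0 := by
  by_contra! h
  obtain ⟨φ, hφ, hneg⟩ := exists_state_neg hy hy0
  rw [← closure_convexHull_extremePoints isCompact_stateSpace convex_stateSpace] at hφ
  have hc : IsClosed {φ : A → ℂ | 0 ≤ (φ y).re} :=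
    isClosed_le continuous_const (Complex.continuous_re.comp (continuous_apply y))
  have hconv : Convex ℝ {φ : A → ℂ | 0 ≤ (φ y).re} := by
    intro φ hφ ψ hψ s t hs ht _
    change 0 ≤ (s • φ y + t • ψ y : ℂ).re
    simp only [Complex.add_re, Complex.smul_re]
    exact add_nonneg (smul_nonneg hs hφ) (smul_nonneg ht hψ)
  have : 0 ≤ (φ y).re := closure_minimal (convexHull_min h hconv) hc hφ
  linarith

end PureState

section Irreducible

variable {H : Type*} [NormedAddCommGroup H] [InnerProductSpace ℂ H] [CompleteSpace H]
  {π : A →⋆ₐ[ℂ] (H →L[ℂ] H)} {ξ : H}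

lemma exists_functional_of_commute {Y : H →L[ℂ] H} (hY : ∀ y, 0 ≤ ⟪y, Y y⟫_ℂ)
    (hc : ∀ a, Y * π a = π a * Y) :
    ∃ g : A →ₚ[ℂ] ℂ, ∀ a, g a = ⟪ξ, Y (π a ξ)⟫_ℂ := by
  refine ⟨PositiveLinearMap.mk₀
    { toFun := fun a => ⟪ξ, Y (π a ξ)⟫_ℂ
      map_add' := fun a b => by simp
      map_smul' := fun c a => by simp } fun a ha => ?_, fun _ => rfl⟩
  obtain ⟨b, rfl⟩ := CStarAlgebra.nonneg_iff_eq_star_mul_self.1 ha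
  change 0 ≤ ⟪ξ, Y (π (star b * b) ξ)⟫_ℂ
  rw [← mul_apply_eq_comp, hc, map_mul, mul_assoc, ← hc, map_star,
    ContinuousLinearMap.star_eq_adjoint, mul_apply_eq_comp,
    ContinuousLinearMap.adjoint_inner_right, mul_apply_eq_comp]
  exact hY _

omit [PartialOrder A] [StarOrderedRing A] in
lemma eq_smul_one_of_inner (hξ : DenseRange fun a => π a ξ) {Y : H →L[ℂ] H} {c : ℂ}
    (hc : ∀ a, Y * π a = π a * Y)
    (h : ∀ a, ⟪ξ, Y (π a ξ)⟫_ℂ = c * ⟪ξ, π a ξ⟫_ℂ) : Y = c • 1 := by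
  have key : ∀ b, Y (π b ξ) = c • π b ξ := by
    intro b
    have : (fun x => ⟪x, Y (π b ξ)⟫_ℂ) =
        fun x => ⟪x, c • π b ξ⟫_ℂ := by
      refine hξ.equalizer (by fun_prop) (by fun_prop) ?_
      ext a
      simp only [Function.comp]
      have := h (star a * b)
      rw [map_mul, ← mul_apply_eq_comp, ← mul_assoc, hc, mul_assoc, map_star,
        ContinuousLinearMap.star_eq_adjoint, mul_apply_eq_comp, mul_apply_eq_comp,
        ContinuousLinearMap.adjoint_inner_right, mul_apply_eq_comp,
        ContinuousLinearMap.adjoint_inner_right] at this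
      rw [inner_smul_right, this]
    exact ext_inner_left ℂ (congrFun this)
  ext x
  have : (fun x => Y x) = fun x => c • x :=
    hξ.equalizer (by fun_prop) (by fun_prop) (funext key)
  exact congrFun this x

lemma isSelfAdjoint_commute_eq_smul_one (hξ : DenseRange fun a => π a ξ)
    {f : A →ₚ[ℂ] ℂ} (hf : ∀ a, f a = ⟪ξ, π a ξ⟫_ℂ)
    (hext : ⇑f ∈ (stateSpace A).extremePoints ℝ)
    {X : H →L[ℂ] H} (hX : IsSelfAdjoint X) (hn : ‖X‖ < 1)
    (hc : ∀ a, X * π a = π a * X) : ∃ c : ℂ, X = c • 1 := by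
  have hreal : ∀ y, ⟪y, X y⟫_ℂ = ((⟪y, X y⟫_ℂ).re : ℂ) := fun y => by
    have : (starRingEnd ℂ) ⟪y, X y⟫_ℂ = ⟪y, X y⟫_ℂ := by
      rw [inner_conj_symm, ← ContinuousLinearMap.adjoint_inner_right,
        ← ContinuousLinearMap.star_eq_adjoint, hX.star_eq]
    exact (Complex.conj_eq_iff_re.1 this).symm
  have habs : ∀ y, |(⟪y, X y⟫_ℂ).re| ≤ ‖X‖ * ‖y‖ ^ 2 := fun y => by
    refine (Complex.abs_re_le_norm _).trans ((norm_inner_le_norm _ _).trans ?_)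
    nlinarith [X.le_opNorm y, norm_nonneg y]
  have hone : ∀ y : H, ⟪y, y⟫_ℂ = ((‖y‖ ^ 2 : ℝ) : ℂ) := fun y => by
    rw [inner_self_eq_norm_sq_to_K]; norm_cast
  have hf1 : f 1 = 1 := hext.1.1
  have hn1 : ‖ξ‖ ^ 2 = 1 := by
    have := hf1
    rw [hf, map_one, one_apply_eq_self, hone] at this
    exact_mod_cast this
  set s : ℝ := (⟪ξ, X ξ⟫_ℂ).re with hs
  have hs1 : |s| < 1 := (habs _).trans_lt (by rw [hn1, mul_one]; exact hn)
  rw [abs_lt] at hs1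
  obtain ⟨g, hg⟩ := exists_functional_of_commute (ξ := ξ) (Y := 1 + X)
    (fun y => by
      rw [add_apply, one_apply_eq_self, inner_add_right, hreal, hone, ← Complex.ofReal_add]
      refine Complex.zero_le_real.2 ?_
      have := (abs_le.1 (habs y)).1
      nlinarith [sq_nonneg ‖y‖])
    (fun a => by rw [add_mul, mul_add, hc, one_mul, mul_one])
  obtain ⟨g', hg'⟩ := exists_functional_of_commute (ξ := ξ) (Y := 1 - X)
    (fun y => by
      rw [sub_apply, one_apply_eq_self, inner_sub_right, hreal, hone, ← Complex.ofReal_sub]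
      refine Complex.zero_le_real.2 ?_
      have := (abs_le.1 (habs y)).2
      nlinarith [sq_nonneg ‖y‖])
    (fun a => by rw [sub_mul, mul_sub, hc, one_mul, mul_one])
  have hg1 : g 1 = ((1 + s : ℝ) : ℂ) := by
    rw [hg, map_one, one_apply_eq_self, add_apply, one_apply_eq_self, inner_add_right, hreal, hone,
      hn1, ← Complex.ofReal_add]
  have hg1' : g' 1 = ((1 - s : ℝ) : ℂ) := by
    rw [hg', map_one, one_apply_eq_self, sub_apply, one_apply_eq_self, inner_sub_right, hreal, hone,
      hn1, ← Complex.ofReal_sub]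
  have h1 : (1 + s)⁻¹ • ⇑g ∈ stateSpace A := smul_mem_stateSpace g (by
    rw [inv_nonneg]; linarith) (by
    rw [hg1, Complex.real_smul, ← Complex.ofReal_mul, inv_mul_cancel₀ (by linarith)]; simp)
  have h2 : (1 - s)⁻¹ • ⇑g' ∈ stateSpace A := smul_mem_stateSpace g' (by
    rw [inv_nonneg]; linarith) (by
    rw [hg1', Complex.real_smul, ← Complex.ofReal_mul, inv_mul_cancel₀ (by linarith)]; simp)
  have hmem : ⇑f ∈ openSegment ℝ ((1 + s)⁻¹ • ⇑g) ((1 - s)⁻¹ • ⇑g') := by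
    refine ⟨(1 + s) / 2, (1 - s) / 2, by linarith, by linarith, by ring, ?_⟩
    rw [smul_smul, smul_smul]
    have e1 : (1 + s) / 2 * (1 + s)⁻¹ = 1 / 2 := by
      have : 1 + s ≠ 0 := by linarith
      field_simp
    have e2 : (1 - s) / 2 * (1 - s)⁻¹ = 1 / 2 := by
      have : 1 - s ≠ 0 := by linarith
      field_simp
    rw [e1, e2]
    ext a
    simp only [Pi.add_apply, Pi.smul_apply, hg, hg', add_apply,
      sub_apply, one_apply_eq_self, inner_add_right, inner_sub_right, hf,
      Complex.real_smul]
    push_cast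
    ring
  have heq := hext.2 h1 h2 hmem
  refine ⟨s, eq_smul_one_of_inner hξ hc fun a => ?_⟩
  have h3 : (1 + s)⁻¹ • g a = f a := congrFun heq a
  rw [hg, hf, add_apply, one_apply_eq_self, inner_add_right,
    Complex.real_smul] at h3
  have h4 : ((1 + s : ℝ) : ℂ) ≠ 0 := by exact_mod_cast (by linarith : 1 + s ≠ 0)
  rw [Complex.ofReal_inv, inv_mul_eq_iff_eq_mul₀ h4] at h3
  push_cast at h3
  linear_combination h3

/-- A cyclic representation whose vector state is extreme is irreducible. -/
theorem commute_eq_smul_one (hξ : DenseRange fun a => π a ξ)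
    {f : A →ₚ[ℂ] ℂ} (hf : ∀ a, f a = ⟪ξ, π a ξ⟫_ℂ)
    (hext : ⇑f ∈ (stateSpace A).extremePoints ℝ)
    (X : H →L[ℂ] H)
    (hc : ∀ a, X * π a = π a * X) : ∃ c : ℂ, X = c • 1 := by
  have hsa : ∀ Y : H →L[ℂ] H, IsSelfAdjoint Y →
      (∀ a, Y * π a = π a * Y) → ∃ c : ℂ, Y = c • 1 := by
    intro Y hY hcY
    have hr : (0 : ℝ) < ‖Y‖ + 1 := by positivity
    obtain ⟨c, h⟩ := isSelfAdjoint_commute_eq_smul_one hξ hf hext (X := (‖Y‖ + 1)⁻¹ • Y)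
      ((IsSelfAdjoint.all _).smul hY)
      (by rw [norm_smul, norm_inv, Real.norm_of_nonneg hr.le, inv_mul_lt_iff₀ hr]; linarith)
      (fun a => by rw [smul_mul_assoc, hcY, mul_smul_comm])
    refine ⟨(‖Y‖ + 1 : ℝ) * c, ?_⟩
    rw [mul_smul, ← h, Complex.coe_smul, smul_smul, mul_inv_cancel₀ hr.ne', one_smul]
  have hcs : ∀ a, star X * π a = π a * star X := fun a => by
    have := congrArg star (hc (star a))
    rw [star_mul, star_mul, ← map_star, star_star] at this
    exact this.symm
  obtain ⟨c, h⟩ := hsa (X + star X) (by simp [IsSelfAdjoint, add_comm]) fun a => by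
    rw [add_mul, mul_add, hc, hcs]
  obtain ⟨d, h'⟩ := hsa (Complex.I • (X - star X))
    (by simp [IsSelfAdjoint, ← smul_neg]) fun a => by
      rw [smul_mul_assoc, mul_smul_comm, sub_mul, mul_sub, hc, hcs]
  refine ⟨(c - Complex.I * d) / 2, ?_⟩
  have h2 : X - star X = -(Complex.I * d) • (1 : H →L[ℂ] H) := by
    rw [neg_smul, mul_smul, ← h', smul_smul, Complex.I_mul_I]; simp
  have h3 : (2 : ℂ) • X = (c - Complex.I * d) • (1 : H →L[ℂ] H) := by
    rw [sub_eq_add_neg, add_smul, ← h, ← h2, two_smul]; abel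
  rw [div_eq_inv_mul, mul_smul, ← h3, smul_smul]; simp

end Irreducible

section Cyclic
variable {H : Type*} [NormedAddCommGroup H] [InnerProductSpace ℂ H] [CompleteSpace H]
  (S : StarSubalgebra ℂ (H →L[ℂ] H))

/-- The closed cyclic subspace generated by `v` under a *-algebra of operators. -/
def cyclicSubspace (v : H) : Submodule ℂ H :=
  Submodule.topologicalClosure
    { carrier := {x | ∃ s ∈ S, s v = x}
      add_mem' := by
        rintro _ _ ⟨s, hs, rfl⟩ ⟨t, ht, rfl⟩
        exact ⟨s + t, add_mem hs ht, rfl⟩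
      zero_mem' := ⟨0, zero_mem S, rfl⟩
      smul_mem' := by
        rintro c _ ⟨s, hs, rfl⟩
        exact ⟨c • s, S.smul_mem hs c, rfl⟩ }

instance (v : H) : CompleteSpace (cyclicSubspace S v) :=
  Submodule.topologicalClosure.completeSpace _

/-- The cyclic subspaces generated by `x` and `y` are orthogonal. -/
def CyclicOrtho (x y : H) : Prop := ∀ s ∈ S, ⟪s x, y⟫_ℂ = 0

variable {S}

lemma isClosed_cyclicSubspace (v : H) : IsClosed (cyclicSubspace S v : Set H) :=
  Submodule.isClosed_topologicalClosure _

lemma mem_cyclicSubspace_of_mem {s : H →L[ℂ] H} (hs : s ∈ S) (v : H) :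
    s v ∈ cyclicSubspace S v :=
  Submodule.le_topologicalClosure _ ⟨s, hs, rfl⟩

lemma self_mem_cyclicSubspace (v : H) : v ∈ cyclicSubspace S v := by
  simpa using mem_cyclicSubspace_of_mem (one_mem S) v

lemma cyclicSubspace_induction {v : H} {p : H → Prop} (hc : IsClosed {x | p x})
    (h : ∀ s ∈ S, p (s v)) {x : H} (hx : x ∈ cyclicSubspace S v) : p x := by
  refine closure_minimal (t := {x | p x}) ?_ hc hx
  rintro _ ⟨s, hs, rfl⟩
  exact h s hs

lemma cyclicSubspace_le {M : Submodule ℂ H} (hM : IsClosed (M : Set H))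
    (hS : ∀ s ∈ S, ∀ x ∈ M, s x ∈ M) {v : H} (hv : v ∈ M) : cyclicSubspace S v ≤ M :=
  fun _ hx => cyclicSubspace_induction hM (fun s hs => hS s hs v hv) hx

lemma apply_mem_cyclicSubspace {s : H →L[ℂ] H} (hs : s ∈ S) {v x : H}
    (hx : x ∈ cyclicSubspace S v) : s x ∈ cyclicSubspace S v := by
  refine cyclicSubspace_induction (p := fun x => s x ∈ cyclicSubspace S v)
    ((isClosed_cyclicSubspace v).preimage s.continuous) (fun t ht => ?_) hx
  exact mem_cyclicSubspace_of_mem (mul_mem hs ht) v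

lemma cyclicSubspace_mono {v x : H} (hx : x ∈ cyclicSubspace S v) :
    cyclicSubspace S x ≤ cyclicSubspace S v :=
  cyclicSubspace_le (isClosed_cyclicSubspace v) (fun _ hs _ => apply_mem_cyclicSubspace hs) hx

omit [CompleteSpace H] in
lemma inner_self_eq_ofReal_norm_sq (x : H) : ⟪x, x⟫_ℂ = ((‖x‖ ^ 2 : ℝ) : ℂ) := by
  rw [inner_self_eq_norm_sq_to_K]
  norm_cast

lemma inner_apply_eq_star (s : H →L[ℂ] H) (x y : H) : ⟪s x, y⟫_ℂ = ⟪x, star s y⟫_ℂ := by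
  rw [ContinuousLinearMap.star_eq_adjoint, ContinuousLinearMap.adjoint_inner_right]

namespace CyclicOrtho

lemma symm {x y : H} (h : CyclicOrtho S x y) : CyclicOrtho S y x := fun s hs => by
  rw [inner_apply_eq_star, inner_eq_zero_symm]
  exact h _ (star_mem hs)

lemma right_mem {x y y' : H} (h : CyclicOrtho S x y) (hy : y' ∈ cyclicSubspace S y) :
    CyclicOrtho S x y' := fun s hs => by
  refine cyclicSubspace_induction (p := fun y' => ⟪s x, y'⟫_ℂ = 0)
    (isClosed_eq (by fun_prop) (by fun_prop)) (fun t ht => ?_) hy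
  have := h.symm _ (mul_mem (star_mem hs) ht)
  rwa [mul_apply_eq_comp, inner_apply_eq_star, star_star, inner_eq_zero_symm] at this

lemma mono {x y x' y' : H} (h : CyclicOrtho S x y) (hx : x' ∈ cyclicSubspace S x)
    (hy : y' ∈ cyclicSubspace S y) : CyclicOrtho S x' y' :=
  ((h.right_mem hy).symm.right_mem hx).symm

lemma inner_eq_zero {x y : H} (h : CyclicOrtho S x y) : ⟪x, y⟫_ℂ = 0 := by
  simpa using h 1 (one_mem S)

lemma add_right {x y z : H} (h : CyclicOrtho S x y) (h' : CyclicOrtho S x z) :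
    CyclicOrtho S x (y + z) := fun s hs => by
  rw [inner_add_right, h s hs, h' s hs, add_zero]

lemma smul_right {x y : H} (h : CyclicOrtho S x y) (c : ℂ) :
    CyclicOrtho S x (c • y) := fun s hs => by
  rw [inner_smul_right, h s hs, mul_zero]

lemma starProjection_eq_zero {x y : H} (h : CyclicOrtho S x y) :
    (cyclicSubspace S x).starProjection y = 0 := by
  rw [Submodule.starProjection_apply_eq_zero_iff, Submodule.mem_orthogonal]
  exact fun u hu => (h.mono hu (self_mem_cyclicSubspace y)).inner_eq_zero

end CyclicOrtho

lemma starProjection_cyclicSubspace_commute {s : H →L[ℂ] H} (hs : s ∈ S) (v : H) :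
    s * (cyclicSubspace S v).starProjection = (cyclicSubspace S v).starProjection * s := by
  ext x
  refine (Submodule.eq_starProjection_of_mem_of_inner_eq_zero
    (apply_mem_cyclicSubspace hs (Submodule.starProjection_apply_mem _ x)) fun w hw => ?_).symm
  change ⟪s x - s _, w⟫_ℂ = 0
  rw [← map_sub, inner_apply_eq_star]
  exact Submodule.starProjection_inner_eq_zero _ _ (apply_mem_cyclicSubspace (star_mem hs) hw)

lemma isSelfAdjoint_starProjection_cyclicSubspace (v : H) :
    IsSelfAdjoint (cyclicSubspace S v).starProjection :=
  isSelfAdjoint_starProjection _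

/-- No two nonzero vectors of the cyclic subspace of `w` generate orthogonal subspaces. -/
def CyclicIrreducible (S : StarSubalgebra ℂ (H →L[ℂ] H)) (w : H) : Prop :=
  ∀ x ∈ cyclicSubspace S w, ∀ y ∈ cyclicSubspace S w, CyclicOrtho S x y → x = 0 ∨ y = 0

/-- Two vectors define the same functional on `S`. -/
def SameVectorState (S : StarSubalgebra ℂ (H →L[ℂ] H)) (x y : H) : Prop :=
  ∀ s ∈ S, ⟪x, s x⟫_ℂ = ⟪y, s y⟫_ℂ

lemma apply_eq_zero_of_inner_eq_zero {P : H →L[ℂ] H} (hP : 0 ≤ P) {w : H}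
    (h : ⟪P w, w⟫_ℂ = 0) : P w = 0 := by
  obtain ⟨b, rfl⟩ := CStarAlgebra.nonneg_iff_eq_star_mul_self.1 hP
  rw [mul_apply_eq_comp, inner_apply_eq_star, star_star, inner_self_eq_zero] at h
  rw [mul_apply_eq_comp, h, map_zero]

lemma CyclicIrreducible.exists_apply_eq_smul {w : H} (hw : CyclicIrreducible S w)
    {X : H →L[ℂ] H} (hX : IsSelfAdjoint X) (hc : ∀ s ∈ S, Commute X s)
    (hp : Commute X (cyclicSubspace S w).starProjection) : ∃ c : ℝ, X w = (c : ℂ) • w := by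
  rcases eq_or_ne w 0 with rfl | hw0
  · exact ⟨0, by simp⟩
  set c : ℝ := (⟪w, X w⟫_ℂ).re / ‖w‖ ^ 2 with hcdef
  have hwn : ‖w‖ ^ 2 ≠ 0 := by positivity
  refine ⟨c, ?_⟩
  set Y : H →L[ℂ] H := X - (c : ℂ) • 1 with hYdef
  have hY : IsSelfAdjoint Y := hX.sub (by simp [IsSelfAdjoint])
  have hYc : ∀ s, Commute X s → Commute Y s := fun s hs =>
    hs.sub_left ((Commute.one_left s).smul_left _)
  have hpos : ∀ s, Commute X s → Commute Y⁺ s := fun s hs => (hYc s hs).cfcₙ_real _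
  have hneg : ∀ s, Commute X s → Commute Y⁻ s := fun s hs => (hYc s hs).cfcₙ_real _
  have hmem : ∀ Z : H →L[ℂ] H, Commute Z (cyclicSubspace S w).starProjection →
      Z w ∈ cyclicSubspace S w := fun Z hZ => by
    have h1 := congrArg (fun T : H →L[ℂ] H => T w) hZ.eq
    simp only [mul_apply_eq_comp] at h1
    rw [Submodule.starProjection_eq_self_iff.2 (self_mem_cyclicSubspace w)] at h1
    rw [h1]
    exact Submodule.starProjection_apply_mem _ _
  have hYw : ⟪w, Y w⟫_ℂ = 0 := by
    have h1 : (starRingEnd ℂ) ⟪w, X w⟫_ℂ = ⟪w, X w⟫_ℂ := by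
      rw [inner_conj_symm, inner_apply_eq_star, hX.star_eq]
    rw [hYdef, sub_apply, smul_apply, one_apply_eq_self, inner_sub_right, inner_smul_right,
      inner_self_eq_ofReal_norm_sq, ← Complex.conj_eq_iff_re.1 h1, hcdef]
    rw [← Complex.ofReal_mul, div_mul_cancel₀ _ hwn, sub_self]
  have hsub : Y w = Y⁺ w - Y⁻ w := by
    rw [← sub_apply, CFC.posPart_sub_negPart Y hY]
  have hort : CyclicOrtho S (Y⁺ w) (Y⁻ w) := fun s hs => by
    rw [← mul_apply_eq_comp, ← (hpos s (hc s hs)).eq, mul_apply_eq_comp, inner_apply_eq_star,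
      (CFC.posPart_nonneg Y).isSelfAdjoint.star_eq, ← mul_apply_eq_comp, CFC.posPart_mul_negPart]
    simp
  have key : Y w = 0 := by
    rcases hw _ (hmem _ (hpos _ hp)) _ (hmem _ (hneg _ hp)) hort with h | h
    · rw [hsub, h, zero_sub, inner_neg_right, neg_eq_zero, inner_eq_zero_symm] at hYw
      rw [hsub, h, apply_eq_zero_of_inner_eq_zero (CFC.negPart_nonneg Y) hYw, sub_zero]
    · rw [hsub, h, sub_zero, inner_eq_zero_symm] at hYw
      rw [hsub, h, apply_eq_zero_of_inner_eq_zero (CFC.posPart_nonneg Y) hYw, sub_zero]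
  rwa [hYdef, sub_apply, smul_apply, one_apply_eq_self, sub_eq_zero] at key

end Cyclic

section Greedy
variable {H : Type*} [NormedAddCommGroup H] [InnerProductSpace ℂ H] [CompleteSpace H]
  {S : StarSubalgebra ℂ (H →L[ℂ] H)}

/-- Either the cyclic subspace of `v + w` contains `w`, or that of `v` contains a vector with the
same state as `w`. -/
lemma CyclicIrreducible.dichotomy {v w : H} (hw : CyclicIrreducible S w)
    (hvw : CyclicOrtho S v w) :
    w ∈ cyclicSubspace S (v + w) ∨ ∃ w' ∈ cyclicSubspace S v, SameVectorState S w' w := by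
  set Q := (cyclicSubspace S (v + w)).starProjection with hQ
  set P := (cyclicSubspace S v).starProjection with hP
  set R := (cyclicSubspace S w).starProjection with hR
  have hQs : ∀ x y, ⟪Q x, y⟫_ℂ = ⟪x, Q y⟫_ℂ := fun x y => by
    rw [inner_apply_eq_star, (isSelfAdjoint_starProjection_cyclicSubspace _).star_eq]
  have hPs : ∀ x y, ⟪P x, y⟫_ℂ = ⟪x, P y⟫_ℂ := fun x y => by
    rw [inner_apply_eq_star, (isSelfAdjoint_starProjection_cyclicSubspace _).star_eq]
  have hRs : ∀ x y, ⟪R x, y⟫_ℂ = ⟪x, R y⟫_ℂ := fun x y => by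
    rw [inner_apply_eq_star, (isSelfAdjoint_starProjection_cyclicSubspace _).star_eq]
  have hQc : ∀ s ∈ S, Commute Q s := fun s hs => (starProjection_cyclicSubspace_commute hs _).symm
  have hPc : ∀ s ∈ S, Commute P s := fun s hs => (starProjection_cyclicSubspace_commute hs _).symm
  have hRc : ∀ s ∈ S, Commute R s := fun s hs => (starProjection_cyclicSubspace_commute hs _).symm
  have hPP : ∀ x, P (P x) = P x := fun x =>
    Submodule.starProjection_eq_self_iff.2 (Submodule.starProjection_apply_mem _ x)
  have hRR : ∀ x, R (R x) = R x := fun x =>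
    Submodule.starProjection_eq_self_iff.2 (Submodule.starProjection_apply_mem _ x)
  have hRR' : R * R = R := ContinuousLinearMap.ext hRR
  have hRw : R w = w := Submodule.starProjection_eq_self_iff.2 (self_mem_cyclicSubspace w)
  have hPv : P v = v := Submodule.starProjection_eq_self_iff.2 (self_mem_cyclicSubspace v)
  have hPw : P w = 0 := hvw.starProjection_eq_zero
  have hRv : R v = 0 := hvw.symm.starProjection_eq_zero
  by_cases h0 : P (Q w) = 0
  · left
    have hsum : ∀ x ∈ cyclicSubspace S (v + w), P x + R x = x := fun x hx => by
      refine cyclicSubspace_induction (p := fun x => P x + R x = x)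
        (isClosed_eq (by fun_prop) (by fun_prop)) (fun s hs => ?_) hx
      have e1 := congrArg (fun T : H →L[ℂ] H => T (v + w)) (hPc s hs).eq
      have e2 := congrArg (fun T : H →L[ℂ] H => T (v + w)) (hRc s hs).eq
      simp only [mul_apply_eq_comp] at e1 e2
      rw [e1, e2, ← map_add]
      simp [hRw, hPv, hPw, hRv]
    have hQw : Q w ∈ cyclicSubspace S w := by
      have := hsum (Q w) (Submodule.starProjection_apply_mem _ _)
      rw [h0, zero_add] at this
      rw [← this]
      exact Submodule.starProjection_apply_mem _ _
    have hQvw : Q v + Q w = v + w := by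
      rw [← map_add]
      exact Submodule.starProjection_eq_self_iff.2 (self_mem_cyclicSubspace _)
    have hQQ : Q (w - Q w) = 0 := by
      rw [map_sub, sub_eq_zero]
      exact (Submodule.starProjection_eq_self_iff.2 (Submodule.starProjection_apply_mem _ w)).symm
    have hy : w - Q w = 0 := by
      rw [← inner_self_eq_zero (𝕜 := ℂ)]
      have hmem : w - Q w ∈ cyclicSubspace S w := sub_mem (self_mem_cyclicSubspace w) hQw
      have e : w - Q w = Q v - v := by
        rw [sub_eq_sub_iff_add_eq_add, add_comm, ← hQvw]
      nth_rewrite 1 [e]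
      rw [inner_sub_left, hQs, hQQ, (hvw.right_mem hmem).inner_eq_zero]
      simp
    exact Submodule.starProjection_eq_self_iff.1 (sub_eq_zero.1 hy).symm
  · right
    obtain ⟨c, hc⟩ := hw.exists_apply_eq_smul (X := R * (Q * P * Q) * R)
      (by
        have hsa := isSelfAdjoint_starProjection_cyclicSubspace (S := S)
        have h1 : star R = R := (hsa w).star_eq
        have h2 : star Q = Q := (hsa (v + w)).star_eq
        have h3 : star P = P := (hsa v).star_eq
        simp [IsSelfAdjoint, star_mul, h1, h2, h3, mul_assoc])
      (fun s hs => (((hRc s hs).mul_left (((hQc s hs).mul_left (hPc s hs)).mul_left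
        (hQc s hs))).mul_left (hRc s hs)))
      (by
        change _ * R = R * _
        rw [mul_assoc _ R R, hRR']
        simp only [← mul_assoc, hRR'])
    simp only [mul_apply_eq_comp, hRw] at hc
    have key : ∀ s ∈ S, ⟪P (Q w), s (P (Q w))⟫_ℂ = c * ⟪w, s w⟫_ℂ := fun s hs => by
      have e1 : ∀ x, s (P x) = P (s x) := fun x =>
        (congrArg (fun T : H →L[ℂ] H => T x) (hPc s hs).eq).symm
      have e2 : ∀ x, s (Q x) = Q (s x) := fun x =>
        (congrArg (fun T : H →L[ℂ] H => T x) (hQc s hs).eq).symm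
      have e3 : ∀ x, s (R x) = R (s x) := fun x =>
        (congrArg (fun T : H →L[ℂ] H => T x) (hRc s hs).eq).symm
      rw [← inner_smul_right, ← map_smul, ← hc, e3, e2, e1, e2, hPs, hPP, ← hRs, hRw, hQs]
    have hc0 : 0 < c := by
      have h1 := key 1 (one_mem S)
      rw [one_apply_eq_self, one_apply_eq_self, inner_self_eq_ofReal_norm_sq,
        inner_self_eq_ofReal_norm_sq, ← Complex.ofReal_mul, Complex.ofReal_inj] at h1
      have h2 : 0 < ‖P (Q w)‖ ^ 2 := by positivity
      rw [h1] at h2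
      exact pos_of_mul_pos_left h2 (sq_nonneg _)
    refine ⟨((√c)⁻¹ : ℂ) • P (Q w),
      Submodule.smul_mem _ _ (Submodule.starProjection_apply_mem _ _), fun s hs => ?_⟩
    rw [map_smul, inner_smul_left, inner_smul_right, key s hs, map_inv₀, Complex.conj_ofReal]
    have h1 : (√c : ℂ) * √c = c := by rw [← Complex.ofReal_mul, Real.mul_self_sqrt hc0.le]
    have h2 : (√c : ℂ) ≠ 0 := by exact_mod_cast (Real.sqrt_pos.2 hc0).ne'
    rw [← h1]
    field_simp

/-- The cyclic subspace of `v` contains `r` nonzero vectors generating pairwise orthogonal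
subspaces. -/
def HasCyclicLength (S : StarSubalgebra ℂ (H →L[ℂ] H)) (v : H) (r : ℕ) : Prop :=
  ∃ u : Fin r → H, (∀ i, u i ∈ cyclicSubspace S v) ∧ (∀ i, u i ≠ 0) ∧
    Pairwise fun i j => CyclicOrtho S (u i) (u j)

lemma pairwise_cyclicOrtho_snoc {r : ℕ} {u : Fin r → H} {w : H}
    (hu : Pairwise fun i j => CyclicOrtho S (u i) (u j)) (hw : ∀ i, CyclicOrtho S (u i) w) :
    Pairwise fun i j => CyclicOrtho S ((Fin.snoc u w : Fin (r + 1) → H) i)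
      ((Fin.snoc u w : Fin (r + 1) → H) j) := by
  intro i j hij
  induction i using Fin.lastCases with
  | last =>
    induction j using Fin.lastCases with
    | last => exact absurd rfl hij
    | cast j => simpa using (hw j).symm
  | cast i =>
    induction j using Fin.lastCases with
    | last => simpa using hw i
    | cast j => simpa using hu fun h => hij (congrArg Fin.castSucc h)

lemma HasCyclicLength.succ {x z w : H} {r : ℕ} (h : HasCyclicLength S x r)
    (hx : x ∈ cyclicSubspace S z) (hw : w ∈ cyclicSubspace S z) (hw0 : w ≠ 0)
    (hxw : CyclicOrtho S x w) : HasCyclicLength S z (r + 1) := by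
  obtain ⟨u, h1, h2, h3⟩ := h
  refine ⟨Fin.snoc u w, fun i => ?_, fun i => ?_, pairwise_cyclicOrtho_snoc h3 fun i =>
    hxw.mono (h1 i) (self_mem_cyclicSubspace w)⟩
  · induction i using Fin.lastCases with
    | last => simpa using hw
    | cast i => simpa using cyclicSubspace_mono hx (h1 i)
  · induction i using Fin.lastCases with
    | last => simpa using hw0
    | cast i => simpa using h2 i

lemma hasCyclicLength_zero (x : H) : HasCyclicLength S x 0 :=
  ⟨Fin.elim0, fun i => i.elim0, fun i => i.elim0, fun i => i.elim0⟩

lemma cyclicOrtho_zero_left (x : H) : CyclicOrtho S 0 x := fun s _ => by simp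

lemma exists_cyclicIrreducible (n : ℕ) {x : H} (hx : x ≠ 0)
    (hn : ∀ r, HasCyclicLength S x r → r ≤ n) :
    ∃ w ∈ cyclicSubspace S x, w ≠ 0 ∧ CyclicIrreducible S w := by
  induction n generalizing x with
  | zero =>
    have := hn _ ((hasCyclicLength_zero 0).succ (zero_mem _) (self_mem_cyclicSubspace x) hx
      (cyclicOrtho_zero_left x))
    omega
  | succ n ih =>
    by_cases hirr : CyclicIrreducible S x
    · exact ⟨x, self_mem_cyclicSubspace x, hx, hirr⟩
    unfold CyclicIrreducible at hirr
    push Not at hirr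
    obtain ⟨y, hy, z, hz, hyz, hy0, hz0⟩ := hirr
    obtain ⟨w, hw, hw0, hwi⟩ := ih hy0 fun r hr => by
      have := hn _ (hr.succ hy hz hz0 hyz)
      omega
    exact ⟨w, cyclicSubspace_mono hy hw, hw0, hwi⟩

lemma exists_greedy_family {N : ℕ} (hN : ∀ v r, HasCyclicLength S v r → r ≤ N) (k : ℕ) :
    ∃ v : Fin k → H, (Pairwise fun i j => CyclicOrtho S (v i) (v j)) ∧
      ∀ w, CyclicIrreducible S w → w ≠ 0 → (∀ i, CyclicOrtho S (v i) w) →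
        ∀ i, ∃ w' ∈ cyclicSubspace S (v i), SameVectorState S w' w := by
  induction k with
  | zero => exact ⟨Fin.elim0, fun i => i.elim0, fun _ _ _ _ i => i.elim0⟩
  | succ k ih =>
    obtain ⟨v, hv, hvw⟩ := ih
    classical
    let p : ℕ → Prop := fun r => ∃ x, (∀ i, CyclicOrtho S (v i) x) ∧ HasCyclicLength S x r
    have hp0 : p 0 := ⟨0, fun i => (cyclicOrtho_zero_left _).symm, hasCyclicLength_zero 0⟩
    obtain ⟨x, hx, hlen⟩ := Nat.findGreatest_spec (Nat.zero_le N) hp0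
    refine ⟨Fin.snoc v x, pairwise_cyclicOrtho_snoc hv hx, fun w hw hw0 hort i => ?_⟩
    have hold : ∀ i, CyclicOrtho S (v i) w := fun i => by simpa using hort i.castSucc
    induction i using Fin.lastCases with
    | cast i => simpa using hvw w hw hw0 hold i
    | last =>
      have hxw : CyclicOrtho S x w := by simpa using hort (Fin.last k)
      rcases hw.dichotomy hxw with h | h
      · exfalso
        have hx' : x ∈ cyclicSubspace S (x + w) := by
          simpa using sub_mem (self_mem_cyclicSubspace (S := S) (x + w)) h
        have h1 := hlen.succ hx' h hw0 hxw
        have h2 := Nat.le_findGreatest (P := p) (hN _ _ h1)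
          ⟨x + w, fun i => (hx i).add_right (hold i), h1⟩
        omega
      · simpa using h

/-- If the cyclic lengths are bounded and a state is carried by at most `m` orthogonal cyclic
subspaces, then `m` orthogonal cyclic subspaces exhaust the space. -/
theorem exists_cyclicOrtho_family {N m : ℕ} (hN : ∀ v r, HasCyclicLength S v r → r ≤ N)
    (hm : ∀ (w : H) (r : ℕ) (u : Fin r → H), w ≠ 0 → (∀ i, SameVectorState S (u i) w) →
      (Pairwise fun i j => CyclicOrtho S (u i) (u j)) → r ≤ m) :
    ∃ v : Fin m → H, (Pairwise fun i j => CyclicOrtho S (v i) (v j)) ∧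
      ∀ x, (∀ i, CyclicOrtho S (v i) x) → x = 0 := by
  obtain ⟨v, hv, hvw⟩ := exists_greedy_family hN m
  refine ⟨v, hv, fun x hx => ?_⟩
  by_contra hx0
  obtain ⟨w, hwx, hw0, hw⟩ := exists_cyclicIrreducible N hx0 (hN x)
  have hort : ∀ i, CyclicOrtho S (v i) w := fun i => (hx i).right_mem hwx
  choose w' hw' hs using hvw w hw hw0 hort
  have := hm w (m + 1) (Fin.snoc w' w) hw0 (fun i => ?_) (pairwise_cyclicOrtho_snoc
    (fun i j hij => (hv hij).mono (hw' i) (hw' j))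
    fun i => (hort i).mono (hw' i) (self_mem_cyclicSubspace w))
  · omega
  · induction i using Fin.lastCases with
    | last =>
      have : SameVectorState S w w := fun _ _ => rfl
      simpa using this
    | cast i => simpa using hs i

end Greedy

section CondExp
variable {H : Type*} [NormedAddCommGroup H] [InnerProductSpace ℂ H] [CompleteSpace H]
  (π : A →⋆ₐ[ℂ] (H →L[ℂ] H))

omit [PartialOrder A] [StarOrderedRing A] in
lemma inner_apply_star_mul (a b : A) (x y : H) :
    ⟪π a x, π b y⟫_ℂ = ⟪x, π (star a * b) y⟫_ℂ := by
  rw [inner_apply_eq_star, ← map_star, map_mul, mul_apply_eq_comp]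

lemma inner_apply_nonneg {a : A} (ha : 0 ≤ a) (z : H) : 0 ≤ ⟪z, π a z⟫_ℂ := by
  obtain ⟨b, rfl⟩ := CStarAlgebra.nonneg_iff_eq_star_mul_self.1 ha
  rw [← inner_apply_star_mul, inner_self_eq_ofReal_norm_sq]
  exact Complex.zero_le_real.2 (sq_nonneg _)

lemma sum_comm_pairs {ι κ : Type*} [Fintype ι] [Fintype κ] (f : ι → ι → κ → κ → ℂ) :
    ∑ i, ∑ j, ∑ k, ∑ l, f i j k l = ∑ k, ∑ l, ∑ i, ∑ j, f i j k l :=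
  calc _ = ∑ i, ∑ k, ∑ j, ∑ l, f i j k l := Finset.sum_congr rfl fun _ _ => Finset.sum_comm
    _ = ∑ k, ∑ i, ∑ j, ∑ l, f i j k l := Finset.sum_comm
    _ = ∑ k, ∑ i, ∑ l, ∑ j, f i j k l :=
      Finset.sum_congr rfl fun _ _ => Finset.sum_congr rfl fun _ _ => Finset.sum_comm
    _ = _ := Finset.sum_congr rfl fun _ _ => Finset.sum_comm

namespace IsCondExp
variable {E : A → A} (hE : IsCondExp E)

/-- A conditional expectation as a bundled positive linear map. -/
noncomputable def toPositiveLinearMap : A →ₚ[ℂ] A :=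
  PositiveLinearMap.mk₀ { toFun := E, map_add' := hE.map_add, map_smul' := hE.map_smul } hE.pos

include hE in
lemma map_star (a : A) : E (star a) = star (E a) :=
  StarHomClass.map_star hE.toPositiveLinearMap a

include hE in
lemma map_sum {ι : Type*} (s : Finset ι) (a : ι → A) : E (∑ i ∈ s, a i) = ∑ i ∈ s, E (a i) :=
  _root_.map_sum hE.toPositiveLinearMap a s

/-- The range of a conditional expectation as a *-subalgebra. -/
noncomputable def range : StarSubalgebra ℂ A where
  carrier := Set.range E
  mul_mem' := by
    rintro _ _ ⟨a, rfl⟩ ⟨b, rfl⟩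
    exact ⟨_, hE.range_mul a b⟩
  add_mem' := by
    rintro _ _ ⟨a, rfl⟩ ⟨b, rfl⟩
    exact ⟨_, hE.map_add a b⟩
  algebraMap_mem' c := ⟨c • 1, by rw [hE.map_smul, hE.map_one, Algebra.algebraMap_eq_smul_one]⟩
  star_mem' := by
    rintro _ ⟨a, rfl⟩
    exact ⟨_, hE.range_star a⟩

/-- The operators representing the range of a conditional expectation. -/
noncomputable def opRange : StarSubalgebra ℂ (H →L[ℂ] H) := hE.range.map π

omit [StarOrderedRing A] in
lemma apply_mem_opRange (a : A) : π (E a) ∈ hE.opRange π := ⟨E a, ⟨a, rfl⟩, rfl⟩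

omit [StarOrderedRing A] in
lemma mem_opRange_iff {s : H →L[ℂ] H} : s ∈ hE.opRange π ↔ ∃ a, π (E a) = s := by
  constructor
  · rintro ⟨_, ⟨a, rfl⟩, rfl⟩
    exact ⟨a, rfl⟩
  · rintro ⟨a, rfl⟩
    exact hE.apply_mem_opRange π a

/-- The vector functional of `v` composed with a conditional expectation. -/
noncomputable def vecFunctional (v : H) : A →ₚ[ℂ] ℂ :=
  PositiveLinearMap.mk₀
    { toFun := fun a => ⟪v, π (E a) v⟫_ℂ
      map_add' := fun a b => by simp [hE.map_add]
      map_smul' := fun c a => by simp [hE.map_smul] }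
    fun a ha => inner_apply_nonneg π (hE.pos a ha) v

lemma vecFunctional_apply (v : H) (a : A) : hE.vecFunctional π v a = ⟪v, π (E a) v⟫_ℂ := rfl

omit hE in
lemma norm_sq_apply_le {K : ℝ} (hpos : ∀ a : A, 0 ≤ a → 0 ≤ K • E a - a) (a : A) (z : H) :
    ‖π a z‖ ^ 2 ≤ K * (⟪z, π (E (star a * a)) z⟫_ℂ).re := by
  have h := inner_apply_nonneg π (hpos _ (star_mul_self_nonneg a)) z
  rw [← Complex.coe_smul, map_sub, _root_.map_smul, sub_apply, smul_apply, inner_sub_right,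
    inner_smul_right, ← inner_apply_star_mul, inner_self_eq_ofReal_norm_sq] at h
  have := (Complex.le_def.1 h).1
  rw [Complex.sub_re, Complex.re_ofReal_mul, Complex.ofReal_re] at this
  simpa using this

/-- Linear combinations of the vectors `v j` with coefficients in the range. -/
noncomputable def combination {κ : Type*} [Fintype κ] (v : κ → H) : (κ → A) →ₗ[ℂ] H where
  toFun b := ∑ j, π (E (b j)) (v j)
  map_add' b c := by simp [hE.map_add, Finset.sum_add_distrib]
  map_smul' c b := by simp [hE.map_smul, Finset.smul_sum]

lemma combination_apply {κ : Type*} [Fintype κ] (v : κ → H) (b : κ → A) :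
    hE.combination π v b = ∑ j, π (E (b j)) (v j) := rfl

lemma dense_range_combination {κ : Type*} [Fintype κ] {v : κ → H}
    (hv : ∀ x, (∀ i, CyclicOrtho (hE.opRange π) (v i) x) → x = 0) :
    Dense (LinearMap.range (hE.combination π v) : Set H) := by
  rw [Submodule.dense_iff_topologicalClosure_eq_top, Submodule.topologicalClosure_eq_top_iff,
    Submodule.eq_bot_iff]
  intro x hx
  classical
  refine hv x fun i s hs => ?_
  obtain ⟨a, rfl⟩ := (hE.mem_opRange_iff π).1 hs
  have := (Submodule.mem_orthogonal _ _).1 hx _ ⟨Pi.single i a, rfl⟩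
  rw [combination_apply, Finset.sum_eq_single i] at this
  · simpa using this
  · intro j _ hj
    have h0 : E 0 = 0 := map_zero hE.toPositiveLinearMap
    simp [hj, h0]
  · simp

/-- The kernel inequality, for a linear combination of vectors with orthogonal cyclic subspaces. -/
lemma norm_sq_sum_combination_le {K : ℝ} (hpos : ∀ a : A, 0 ≤ a → 0 ≤ K • E a - a)
    {κ ι : Type*} [Fintype κ] [Fintype ι] {v : κ → H}
    (hv : Pairwise fun i j => CyclicOrtho (hE.opRange π) (v i) (v j)) (a : ι → A)
    (b : ι → κ → A) :
    ‖∑ i, π (a i) (hE.combination π v (b i))‖ ^ 2 ≤ Fintype.card κ * K *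
      (∑ i, ∑ j, ⟪hE.combination π v (b i), π (E (star (a i) * a j))
        (hE.combination π v (b j))⟫_ℂ).re := by
  set c : κ → A := fun k => ∑ i, a i * E (b i k) with hc
  have h1 : ∑ i, π (a i) (hE.combination π v (b i)) = ∑ k, π (c k) (v k) := by
    simp_rw [combination_apply, _root_.map_sum, hc, _root_.map_sum, sum_apply, map_mul,
      mul_apply_eq_comp]
    rw [Finset.sum_comm]
  have h2 : ∀ k l, ⟪v k, π (E (star (c k) * c l)) (v l)⟫_ℂ =
      ∑ i, ∑ j, ⟪π (E (b i k)) (v k), π (E (star (a i) * a j)) (π (E (b j l)) (v l))⟫_ℂ := by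
    intro k l
    simp_rw [hc, star_sum, Finset.sum_mul_sum, hE.map_sum, _root_.map_sum, sum_apply, inner_sum]
    refine Finset.sum_congr rfl fun i _ => Finset.sum_congr rfl fun j _ => ?_
    have h3 : star (a i * E (b i k)) * (a j * E (b j l)) =
        E (star (b i k)) * (star (a i) * a j) * E (b j l) := by
      rw [star_mul, hE.map_star]; simp only [mul_assoc]
    rw [h3, hE.bimod, hE.map_star, map_mul, mul_apply_eq_comp, map_mul, mul_apply_eq_comp,
      inner_apply_eq_star, ← StarHomClass.map_star]
  have h4 : ∑ i, ∑ j, ⟪hE.combination π v (b i), π (E (star (a i) * a j))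
        (hE.combination π v (b j))⟫_ℂ = ∑ k, ⟪v k, π (E (star (c k) * c k)) (v k)⟫_ℂ := by
    calc _ = ∑ k, ∑ l, ⟪v k, π (E (star (c k) * c l)) (v l)⟫_ℂ := by
          simp_rw [h2, combination_apply, _root_.map_sum, sum_inner, inner_sum]
          exact sum_comm_pairs _
      _ = _ := by
          refine Finset.sum_congr rfl fun k _ => ?_
          refine Finset.sum_eq_single k (fun l _ hl => ?_) (by simp)
          exact ((hv hl).symm).right_mem (apply_mem_cyclicSubspace (hE.apply_mem_opRange π _)
            (self_mem_cyclicSubspace _)) |>.inner_eq_zero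
  rw [h1, h4, Complex.re_sum, mul_assoc, Finset.mul_sum]
  calc _ ≤ (∑ k, ‖π (c k) (v k)‖) ^ 2 := by gcongr; exact norm_sum_le _ _
    _ ≤ Fintype.card κ * ∑ k, ‖π (c k) (v k)‖ ^ 2 := sq_sum_le_card_mul_sum_sq
    _ ≤ _ := by
      gcongr
      exact norm_sq_apply_le π hpos _ _

omit [PartialOrder A] [StarOrderedRing A] in
/-- The kernel inequality extends from a set to its closure. -/
lemma norm_sq_sum_le_of_closure {L : ℝ} {ι : Type*} [Fintype ι] (a : ι → A) {D : Set H}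
    (h : ∀ u : ι → H, (∀ i, u i ∈ D) → ‖∑ i, π (a i) (u i)‖ ^ 2 ≤ L *
      (∑ i, ∑ j, ⟪u i, π (E (star (a i) * a j)) (u j)⟫_ℂ).re) (u : ι → H)
    (hu : ∀ i, u i ∈ closure D) : ‖∑ i, π (a i) (u i)‖ ^ 2 ≤ L *
      (∑ i, ∑ j, ⟪u i, π (E (star (a i) * a j)) (u j)⟫_ℂ).re := by
  have hcl : IsClosed {u : ι → H | ‖∑ i, π (a i) (u i)‖ ^ 2 ≤ L *
      (∑ i, ∑ j, ⟪u i, π (E (star (a i) * a j)) (u j)⟫_ℂ).re} :=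
    isClosed_le (by fun_prop) (by fun_prop)
  have hmem : u ∈ closure (Set.univ.pi fun _ : ι => D) := by
    rw [closure_pi_set]
    exact fun i _ => hu i
  exact closure_minimal (fun u hu => h u fun i => Set.mem_univ_pi.1 hu i) hcl hmem

/-- The kernel inequality for vectors spanning orthogonal cyclic subspaces inside a cyclic one. -/
lemma norm_sq_sum_le_of_mem_cyclicSubspace {K : ℝ}
    (hpos : ∀ a : A, 0 ≤ a → 0 ≤ K • E a - a) {ι : Type*} [Fintype ι] (a : ι → A) {v : H}
    {u : ι → H} (hu : ∀ i, u i ∈ cyclicSubspace (hE.opRange π) v)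
    (hort : Pairwise fun i j => CyclicOrtho (hE.opRange π) (u i) (u j)) :
    ‖∑ i, π (a i) (u i)‖ ^ 2 ≤
      K * ∑ i, (⟪u i, π (E (star (a i) * a i)) (u i)⟫_ℂ).re := by
  have h := norm_sq_sum_le_of_closure π (E := E) (L := K) a
    (D := {x | ∃ s ∈ hE.opRange π, s v = x}) (fun u hu => ?_) u hu
  · refine h.trans_eq ?_
    rw [Complex.re_sum]
    congr 1
    refine Finset.sum_congr rfl fun i _ => ?_
    rw [Finset.sum_eq_single i (fun l _ hl => ?_) (by simp)]
    exact ((hort hl).symm).right_mem (apply_mem_cyclicSubspace (hE.apply_mem_opRange π _)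
      (self_mem_cyclicSubspace _)) |>.inner_eq_zero
  · have hb : ∀ i, ∃ b, π (E b) v = u i := fun i => by
      obtain ⟨s, hs, hsv⟩ := hu i
      obtain ⟨b, rfl⟩ := (hE.mem_opRange_iff π).1 hs
      exact ⟨b, hsv⟩
    choose b hb using hb
    have := hE.norm_sq_sum_combination_le π hpos (κ := Unit) (v := fun _ => v)
      (fun i j hij => absurd rfl hij) a fun i _ => b i
    simpa [combination_apply, hb] using this

end IsCondExp
end CondExp

section Bounds
open ContinuousLinearMap (adjoint adjoint_inner_left adjoint_inner_right)
open Filter Topology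
variable {G H : Type*} [NormedAddCommGroup G] [InnerProductSpace ℂ G] [CompleteSpace G]
  [NormedAddCommGroup H] [InnerProductSpace ℂ H] [CompleteSpace H]

/-- If `T` is a multiple of a coisometry mapping `ξ` to a vector at least as long, then vectors in
the target are approximated by images of elements of a dense set that are not longer. -/
lemma exists_near_of_comp_adjoint_eq_smul {T : G →L[ℂ] H} {c : ℂ}
    (hT : T ∘L adjoint T = c • 1) {ξ : G} (hξ : ‖ξ‖ = 1) (hTξ : ‖T ξ‖ = 1)
    {D : Set G} (hD : Dense D) (η : H) {ε : ℝ} (hε : 0 < ε) :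
    ∃ y ∈ D, ‖T y - η‖ < ε ∧ ‖y‖ ^ 2 < ‖η‖ ^ 2 + ε := by
  have hTT : ∀ x, T (adjoint T x) = c • x := fun x => by
    simpa using congrArg (fun X : H →L[ℂ] H => X x) hT
  have hnorm : ∀ x, ((‖adjoint T x‖ ^ 2 : ℝ) : ℂ) = c * (‖x‖ ^ 2 : ℝ) := fun x => by
    rw [← inner_self_eq_ofReal_norm_sq, adjoint_inner_left, hTT, inner_smul_right,
      inner_self_eq_ofReal_norm_sq]
  have h1 := hnorm (T ξ)
  rw [hTξ, one_pow, Complex.ofReal_one, mul_one] at h1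
  have hc : 1 ≤ ‖adjoint T (T ξ)‖ := by
    have h2 : ‖⟪adjoint T (T ξ), ξ⟫_ℂ‖ ≤ ‖adjoint T (T ξ)‖ * ‖ξ‖ := norm_inner_le_norm _ _
    rw [adjoint_inner_left, inner_self_eq_ofReal_norm_sq, hTξ, hξ] at h2
    simpa using h2
  set t : ℝ := ‖adjoint T (T ξ)‖ ^ 2 with ht
  have ht1 : 1 ≤ t := one_le_pow₀ hc
  have ht0 : t ≠ 0 := by positivity
  set y : G := (t⁻¹ : ℂ) • adjoint T η with hy
  have hTy : T y = η := by
    rw [hy, map_smul, hTT, ← h1, smul_smul, inv_mul_cancel₀ (by exact_mod_cast ht0), one_smul]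
  have hyn : ‖y‖ ^ 2 ≤ ‖η‖ ^ 2 := by
    have h2 := hnorm η
    rw [← h1, ← Complex.ofReal_mul, Complex.ofReal_inj] at h2
    rw [hy, norm_smul, mul_pow, h2, norm_inv, Complex.norm_real,
      Real.norm_of_nonneg (by positivity)]
    have : t⁻¹ ^ 2 * (t * ‖η‖ ^ 2) = t⁻¹ * ‖η‖ ^ 2 := by field_simp
    rw [this]
    exact mul_le_of_le_one_left (sq_nonneg _) (inv_le_one_of_one_le₀ ht1)
  have hopen : IsOpen {y : G | ‖T y - η‖ < ε ∧ ‖y‖ ^ 2 < ‖η‖ ^ 2 + ε} :=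
    (isOpen_lt (f := fun y => ‖T y - η‖) (by fun_prop) continuous_const).inter
      (isOpen_lt (f := fun y : G => ‖y‖ ^ 2) (by fun_prop) continuous_const)
  obtain ⟨z, hz, hzD⟩ := hD.inter_open_nonempty _ hopen ⟨y, by simpa [hTy] using hε, by linarith⟩
  exact ⟨z, hzD, hz⟩

variable (π : A →⋆ₐ[ℂ] (H →L[ℂ] H))

lemma PositiveLinearMap.gns_intertwiner_comp_adjoint (f : A →ₚ[ℂ] ℂ)
    (hirr : ∀ X : H →L[ℂ] H, (∀ a, X * π a = π a * X) → ∃ c : ℂ, X = c • 1)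
    {T T' : f.GNS →L[ℂ] H} {z z' : H} (hT : ∀ a, T (f.gnsStarAlgHom a f.gnsVec) = π a z)
    (hT' : ∀ a, T' (f.gnsStarAlgHom a f.gnsVec) = π a z') :
    ∃ c : ℂ, T ∘L adjoint T' = c • 1 := by
  refine hirr _ fun a => ?_
  ext x
  change T (adjoint T' (π a x)) = π a (T (adjoint T' x))
  rw [f.gns_intertwiner_adjoint_apply π hT', f.gns_intertwiner_apply π hT]

namespace IsCondExp
variable {E : A → A} (hE : IsCondExp E) {K : ℝ}

include hE in
lemma exists_apply_near (hpos : ∀ a : A, 0 ≤ a → 0 ≤ K • E a - a)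
    (hirr : ∀ X : H →L[ℂ] H, (∀ a, X * π a = π a * X) → ∃ c : ℂ, X = c • 1)
    {v : H} (hv : ‖v‖ = 1) (η : H) {ε : ℝ} (hε : 0 < ε) :
    ∃ a, ‖π a v - η‖ < ε ∧ (⟪v, π (E (star a * a)) v⟫_ℂ).re < ‖η‖ ^ 2 + ε := by
  set f := hE.vecFunctional π v with hf
  obtain ⟨T, hT⟩ := f.exists_gns_intertwiner π v fun a => norm_sq_apply_le π hpos a v
  obtain ⟨c, hc⟩ := f.gns_intertwiner_comp_adjoint π hirr hT hT
  have hξ : ‖f.gnsVec‖ = 1 := by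
    have h1 := f.norm_gnsVec_sq
    rw [hf, vecFunctional_apply, hE.map_one, _root_.map_one, one_apply_eq_self,
      inner_self_eq_ofReal_norm_sq, hv, Complex.ofReal_re] at h1
    exact (sq_eq_sq₀ (norm_nonneg _) zero_le_one).1 h1
  have hTξ : T f.gnsVec = v := by simpa using hT 1
  obtain ⟨_, ⟨a, rfl⟩, h1, h2⟩ := exists_near_of_comp_adjoint_eq_smul hc hξ
    (by rw [hTξ, hv]) f.denseRange_gns η hε
  refine ⟨a, by simpa only [hT] using h1, ?_⟩
  have h3 := congrArg Complex.re (f.inner_gns_apply_gnsVec a a)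
  rw [inner_self_eq_ofReal_norm_sq, Complex.ofReal_re] at h3
  rw [h3] at h2
  exact h2

/-- Cyclic lengths are bounded by the domination constant. -/
lemma le_of_hasCyclicLength (hK : 0 ≤ K) (hpos : ∀ a : A, 0 ≤ a → 0 ≤ K • E a - a)
    (hirr : ∀ X : H →L[ℂ] H, (∀ a, X * π a = π a * X) → ∃ c : ℂ, X = c • 1)
    {v : H} {r : ℕ} (hr : HasCyclicLength (hE.opRange π) v r) : (r : ℝ) ≤ K := by
  obtain ⟨u, hu, hu0, hort⟩ := hr
  rcases Nat.eq_zero_or_pos r with rfl | hr0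
  · simpa using hK
  set w : Fin r → H := fun i => ((‖u i‖⁻¹ : ℝ) : ℂ) • u i with hw
  have hw1 : ∀ i, ‖w i‖ = 1 := fun i => by
    have := norm_ne_zero_iff.2 (hu0 i)
    simp [hw, norm_smul, this]
  have hwmem : ∀ i, w i ∈ cyclicSubspace (hE.opRange π) v := fun i =>
    Submodule.smul_mem _ _ (hu i)
  have hwort : Pairwise fun i j => CyclicOrtho (hE.opRange π) (w i) (w j) := fun i j hij =>
    (((hort hij).smul_right _).symm.smul_right _).symm
  set η := w ⟨0, hr0⟩ with hη
  have hr' : (0 : ℝ) < r := by exact_mod_cast hr0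
  have key : ∀ ε ∈ Set.Ioo (0 : ℝ) 1, (r : ℝ) * (1 - ε) ^ 2 ≤ K * (1 + ε) := by
    rintro ε ⟨h0, h1⟩
    choose a ha hb using fun i => hE.exists_apply_near π hpos hirr (hw1 i) η h0
    have h2 := hE.norm_sq_sum_le_of_mem_cyclicSubspace π hpos a hwmem hwort
    have h3 : ∑ i, (⟪w i, π (E (star (a i) * a i)) (w i)⟫_ℂ).re ≤ r * (1 + ε) := by
      calc _ ≤ ∑ i : Fin r, (1 + ε) := Finset.sum_le_sum fun i _ => by
            have := hb i
            rw [hη, hw1, one_pow] at this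
            exact this.le
        _ = _ := by
          rw [Finset.sum_const, Finset.card_univ, Fintype.card_fin, nsmul_eq_mul]
    have h4 : (r : ℝ) * (1 - ε) ≤ ‖∑ i, π (a i) (w i)‖ := by
      have h5 : ‖∑ i, (π (a i) (w i) - η)‖ ≤ r * ε := by
        calc _ ≤ ∑ i : Fin r, ε := norm_sum_le_of_le _ fun i _ => (ha i).le
          _ = _ := by simp
      have h6 : ‖∑ i : Fin r, η‖ = r := by
        rw [Finset.sum_const, Finset.card_univ, Fintype.card_fin, ← Nat.cast_smul_eq_nsmul ℂ,
          norm_smul, hη, hw1]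
        simp
      have h7 := norm_sub_norm_le (∑ i : Fin r, η) (∑ i, π (a i) (w i))
      rw [norm_sub_rev, ← Finset.sum_sub_distrib, h6] at h7
      linarith
    have h5 : ((r : ℝ) * (1 - ε)) ^ 2 ≤ K * (r * (1 + ε)) := by
      calc _ ≤ ‖∑ i, π (a i) (w i)‖ ^ 2 := by
            gcongr
        _ ≤ _ := h2.trans (by gcongr)
    refine le_of_mul_le_mul_left ?_ hr'
    linarith
  have hl : Tendsto (fun ε : ℝ => (r : ℝ) * (1 - ε) ^ 2) (𝓝[>] 0) (𝓝 ((r : ℝ) * (1 - 0) ^ 2)) :=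
    ((by fun_prop : Continuous fun ε : ℝ => (r : ℝ) * (1 - ε) ^ 2).tendsto 0).mono_left
      nhdsWithin_le_nhds
  have hr : Tendsto (fun ε : ℝ => K * (1 + ε)) (𝓝[>] 0) (𝓝 (K * (1 + 0))) :=
    ((by fun_prop : Continuous fun ε : ℝ => K * (1 + ε)).tendsto 0).mono_left
      nhdsWithin_le_nhds
  simpa using le_of_tendsto_of_tendsto hl hr
    (eventually_of_mem (Ioo_mem_nhdsGT one_pos) key)

end IsCondExp

/-- Operators carrying a vector to `r` vectors of the same length, with pairwise scalar
products, see at most `K` orthogonal target vectors. -/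
lemma le_of_comp_adjoint_eq_smul {K : ℝ} (hK : 0 ≤ K) {r : ℕ} {T : Fin r → G →L[ℂ] H} {ξ : G}
    {u : Fin r → H} (hT : ∀ i, T i ξ = u i) (hn : ∀ i, ‖u i‖ = ‖ξ‖) (hξ : ξ ≠ 0)
    (hTK : ∀ i y, ‖T i y‖ ^ 2 ≤ K * ‖y‖ ^ 2)
    (hc : ∀ i j, ∃ c : ℂ, T i ∘L adjoint (T j) = c • 1)
    (hort : Pairwise fun i j => ⟪u i, u j⟫_ℂ = 0) : (r : ℝ) ≤ K := by
  set q := ‖ξ‖ ^ 2 with hq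
  have hq0 : 0 < q := by positivity
  set x : Fin r → G := fun i => adjoint (T i) (u i) with hx
  have hxort : ∀ i j, i ≠ j → ⟪x i, x j⟫_ℂ = 0 := fun i j hij => by
    obtain ⟨c, hc⟩ := hc i j
    have h1 : T i (adjoint (T j) (u j)) = c • u j := by
      simpa using congrArg (fun X : H →L[ℂ] H => X (u j)) hc
    rw [hx]
    simp only
    rw [adjoint_inner_left, h1, inner_smul_right, hort hij, mul_zero]
  have hxn : ∀ i, ‖x i‖ ^ 2 ≤ K * q := fun i => by
    have h1 : ‖x i‖ ^ 2 ≤ ‖u i‖ * ‖T i (x i)‖ := by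
      have h2 : ⟪x i, x i⟫_ℂ = ⟪u i, T i (x i)⟫_ℂ := adjoint_inner_left _ _ _
      have h3 := norm_inner_le_norm (𝕜 := ℂ) (u i) (T i (x i))
      rwa [← h2, inner_self_eq_ofReal_norm_sq, Complex.norm_real,
        Real.norm_of_nonneg (sq_nonneg _)] at h3
    have h4 := hTK i (x i)
    have h5 : (‖x i‖ ^ 2) ^ 2 ≤ q * (K * ‖x i‖ ^ 2) := by
      calc _ ≤ (‖u i‖ * ‖T i (x i)‖) ^ 2 := by gcongr
        _ = q * ‖T i (x i)‖ ^ 2 := by rw [mul_pow, hn]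
        _ ≤ _ := by gcongr
    by_contra! h
    have h6 : 0 < ‖x i‖ ^ 2 := lt_of_le_of_lt (by positivity) h
    nlinarith
  have hsum : (r : ℝ) * q ≤ ‖ξ‖ * ‖∑ i, x i‖ := by
    have h1 : ⟪ξ, ∑ i, x i⟫_ℂ = ((r * q : ℝ) : ℂ) := by
      rw [inner_sum]
      simp_rw [hx, adjoint_inner_right, hT, inner_self_eq_ofReal_norm_sq, hn]
      simp [hq]
    have h2 := norm_inner_le_norm (𝕜 := ℂ) ξ (∑ i, x i)
    rwa [h1, Complex.norm_real, Real.norm_of_nonneg (by positivity)] at h2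
  have hsq : ‖∑ i, x i‖ ^ 2 ≤ r * (K * q) := by
    have h1 : ((‖∑ i, x i‖ ^ 2 : ℝ) : ℂ) = ((∑ i, ‖x i‖ ^ 2 : ℝ) : ℂ) := by
      rw [← inner_self_eq_ofReal_norm_sq, sum_inner, Complex.ofReal_sum]
      refine Finset.sum_congr rfl fun i _ => ?_
      rw [inner_sum, Finset.sum_eq_single i (fun j _ hj => hxort i j hj.symm) (by simp),
        inner_self_eq_ofReal_norm_sq]
    rw [Complex.ofReal_inj.1 h1]
    calc _ ≤ ∑ i : Fin r, K * q := Finset.sum_le_sum fun i _ => hxn i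
      _ = _ := by simp
  rcases Nat.eq_zero_or_pos r with rfl | hr0
  · simpa using hK
  have hr' : (0 : ℝ) < r := by exact_mod_cast hr0
  have h1 : ((r : ℝ) * q) ^ 2 ≤ q * (r * (K * q)) := by
    calc _ ≤ (‖ξ‖ * ‖∑ i, x i‖) ^ 2 := by gcongr
      _ = q * ‖∑ i, x i‖ ^ 2 := by rw [mul_pow]
      _ ≤ _ := by gcongr
  refine le_of_mul_le_mul_left (a := r * q ^ 2) ?_ (by positivity)
  linarith

namespace IsCondExp
variable {E : A → A} (hE : IsCondExp E) {K : ℝ}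

/-- A vector state of the range is carried by at most `K` orthogonal cyclic subspaces. -/
lemma le_of_sameVectorState (hK : 0 ≤ K) (hpos : ∀ a : A, 0 ≤ a → 0 ≤ K • E a - a)
    (hirr : ∀ X : H →L[ℂ] H, (∀ a, X * π a = π a * X) → ∃ c : ℂ, X = c • 1)
    {w : H} {r : ℕ} {u : Fin r → H} (hw : w ≠ 0)
    (hu : ∀ i, SameVectorState (hE.opRange π) (u i) w)
    (hort : Pairwise fun i j => CyclicOrtho (hE.opRange π) (u i) (u j)) : (r : ℝ) ≤ K := by
  set f := hE.vecFunctional π w with hf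
  have hdom : ∀ i a, ‖π a (u i)‖ ^ 2 ≤ K * (f (star a * a)).re := fun i a => by
    rw [hf, vecFunctional_apply, ← hu i _ (hE.apply_mem_opRange π _)]
    exact norm_sq_apply_le π hpos a _
  choose T hT using fun i => f.exists_gns_intertwiner π (u i) (hdom i)
  have hξ : ‖f.gnsVec‖ = ‖w‖ := by
    have h1 := f.norm_gnsVec_sq
    rw [hf, vecFunctional_apply, hE.map_one, _root_.map_one, one_apply_eq_self,
      inner_self_eq_ofReal_norm_sq, Complex.ofReal_re] at h1
    exact (sq_eq_sq₀ (norm_nonneg _) (norm_nonneg _)).1 h1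
  refine le_of_comp_adjoint_eq_smul hK (T := T) (ξ := f.gnsVec) (u := u)
    (fun i => by simpa using hT i 1) (fun i => ?_) ?_ (fun i y => ?_)
    (fun i j => f.gns_intertwiner_comp_adjoint π hirr (hT i) (hT j))
    fun i j hij => (hort hij).inner_eq_zero
  · have h1 := hu i 1 (one_mem _)
    rw [one_apply_eq_self, one_apply_eq_self, inner_self_eq_ofReal_norm_sq,
      inner_self_eq_ofReal_norm_sq, Complex.ofReal_inj] at h1
    rw [hξ]
    exact (sq_eq_sq₀ (norm_nonneg _) (norm_nonneg _)).1 h1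
  · rw [← norm_ne_zero_iff, hξ]
    exact norm_ne_zero_iff.2 hw
  · refine f.denseRange_gns.induction_on (p := fun y => ‖T i y‖ ^ 2 ≤ K * ‖y‖ ^ 2) y
      (isClosed_le (by fun_prop) (by fun_prop)) fun a => ?_
    have h3 := congrArg Complex.re (f.inner_gns_apply_gnsVec a a)
    rw [inner_self_eq_ofReal_norm_sq, Complex.ofReal_re] at h3
    rw [hT, h3]
    exact hdom i a

include hE in
/-- The kernel inequality with constant `K ⌊K⌋` in an irreducible representation. -/
theorem norm_sq_sum_le_of_irreducible (hK : 0 ≤ K) (hpos : ∀ a : A, 0 ≤ a → 0 ≤ K • E a - a)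
    (hirr : ∀ X : H →L[ℂ] H, (∀ a, X * π a = π a * X) → ∃ c : ℂ, X = c • 1)
    {ι : Type*} [Fintype ι] (a : ι → A) (u : ι → H) :
    ‖∑ i, π (a i) (u i)‖ ^ 2 ≤ ⌊K⌋₊ * K *
      (∑ i, ∑ j, ⟪u i, π (E (star (a i) * a j)) (u j)⟫_ℂ).re := by
  obtain ⟨v, hv, hv0⟩ := exists_cyclicOrtho_family (S := hE.opRange π) (N := ⌊K⌋₊) (m := ⌊K⌋₊)
    (fun v r hr => Nat.le_floor (hE.le_of_hasCyclicLength π hK hpos hirr hr))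
    (fun w r u hw hu hort => Nat.le_floor (hE.le_of_sameVectorState π hK hpos hirr hw hu hort))
  refine norm_sq_sum_le_of_closure π a (fun u hu => ?_) u
    fun i => (hE.dense_range_combination π hv0) (u i)
  choose b hb using hu
  simpa [hb] using hE.norm_sq_sum_combination_le π hpos hv a b

end IsCondExp
end Bounds

section Matrices

/-- Testing a self-adjoint element against its negative part yields a nonpositive element, and the
element is positive if this vanishes. -/
lemma exists_conj_eq_neg_star_mul_self {R : Type*} [CStarAlgebra R] {X : R}
    (hX : IsSelfAdjoint X) : ∃ N D : R, star N * X * N = -(star (D * N) * (D * N)) ∧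
      (D * N = 0 → ∃ C, X = star C * C) := by
  let := CStarAlgebra.spectralOrder R
  have := CStarAlgebra.spectralOrderedRing R
  obtain ⟨D, hD⟩ := CStarAlgebra.nonneg_iff_eq_star_mul_self.1 (CFC.negPart_nonneg X)
  have hN : star X⁻ = X⁻ := (CFC.negPart_nonneg X).isSelfAdjoint.star_eq
  refine ⟨X⁻, D, ?_, fun h => ?_⟩
  · nth_rewrite 2 [← CFC.posPart_sub_negPart X hX]
    rw [mul_assoc, sub_mul, CFC.posPart_mul_negPart, zero_sub, mul_neg, star_mul, hN, mul_assoc,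
      ← mul_assoc (star D), ← hD]
  · rw [← CStarAlgebra.nonneg_iff_eq_star_mul_self, ← CFC.negPart_eq_zero_iff X hX,
      ← CStarRing.star_mul_self_eq_zero_iff, hN]
    nth_rewrite 1 [hD]
    rw [mul_assoc, h, mul_zero]

variable {n : Type*} [Fintype n]

lemma Matrix.eq_zero_of_diag_star_mul_self_nonpos {D : Matrix n n A}
    (h : ∀ j, (star D * D) j j ≤ 0) : D = 0 := by
  ext i j
  have h1 : ∑ k, star (D k j) * D k j ≤ 0 := by
    simpa [Matrix.mul_apply, Matrix.star_apply] using h j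
  have h2 := (Finset.sum_eq_zero_iff_of_nonneg fun k _ => star_mul_self_nonneg (D k j)).1
    (le_antisymm h1 (Finset.sum_nonneg fun k _ => star_mul_self_nonneg (D k j))) i
    (Finset.mem_univ i)
  simpa using (CStarRing.star_mul_self_eq_zero_iff _).1 h2

/-- A self-adjoint matrix over a C*-algebra is positive if its quadratic form is. -/
lemma Matrix.exists_eq_star_mul_self_of_forall_sum_nonneg {X : Matrix n n A} (hX : star X = X)
    (h : ∀ c : n → A, 0 ≤ ∑ s, ∑ t, star (c s) * X s t * c t) :
    ∃ C : Matrix n n A, X = star C * C := by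
  classical
  have hconj : ∃ N D : Matrix n n A, star N * X * N = -(star (D * N) * (D * N)) ∧
      (D * N = 0 → ∃ C, X = star C * C) :=
    exists_conj_eq_neg_star_mul_self (R := CStarMatrix n n A) hX
  obtain ⟨N, D, hND, hX0⟩ := hconj
  refine hX0 (Matrix.eq_zero_of_diag_star_mul_self_nonpos fun j => ?_)
  rw [← neg_nonneg, ← Matrix.neg_apply, ← hND]
  refine (h fun s => N s j).trans_eq ?_
  simp_rw [Matrix.mul_apply, Finset.sum_mul, Matrix.star_apply]
  rw [Finset.sum_comm]

end Matrices

section Conclusion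

lemma nonneg_of_forall_extreme_state {y : A} (hy : IsSelfAdjoint y)
    (h : ∀ f : A →ₚ[ℂ] ℂ, ⇑f ∈ (stateSpace A).extremePoints ℝ → 0 ≤ (f y).re) : 0 ≤ y := by
  by_contra hy0
  obtain ⟨φ, hφ, hneg⟩ := exists_extreme_state_neg hy hy0
  obtain ⟨-, f, rfl⟩ := hφ.1
  exact absurd (h f hφ) (not_le.2 hneg)

namespace IsCondExp
variable {E : A → A} (hE : IsCondExp E) {K L : ℝ}

include hE in
lemma re_inner_sum_nonneg {H : Type*} [NormedAddCommGroup H] [InnerProductSpace ℂ H]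
    [CompleteSpace H] (π : A →⋆ₐ[ℂ] (H →L[ℂ] H)) (hK : 1 ≤ K)
    (hpos : ∀ a : A, 0 ≤ a → 0 ≤ K • E a - a) (hL : ⌊K⌋₊ * K ≤ L)
    (hirr : ∀ X : H →L[ℂ] H, (∀ a, X * π a = π a * X) → ∃ c : ℂ, X = c • 1)
    {ι : Type*} [Fintype ι] (a c : ι → A) (ξ : H) :
    0 ≤ (⟪ξ, π (∑ s, ∑ t, star (c s) * (L • E (star (a s) * a t) - star (a s) * a t) * c t)
      ξ⟫_ℂ).re := by
  set G := ∑ i, ∑ j, ⟪π (c i) ξ, π (E (star (a i) * a j)) (π (c j) ξ)⟫_ℂ with hG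
  have h1 := hE.norm_sq_sum_le_of_irreducible π (zero_le_one.trans hK) hpos hirr a
    fun s => π (c s) ξ
  rw [← hG] at h1
  have h2 : ⟪ξ, π (∑ s, ∑ t, star (c s) * (L • E (star (a s) * a t) - star (a s) * a t) * c t)
      ξ⟫_ℂ = L * G - (‖∑ i, π (a i) (π (c i) ξ)‖ ^ 2 : ℝ) := by
    rw [← inner_self_eq_ofReal_norm_sq, sum_inner, hG, Finset.mul_sum, ← Finset.sum_sub_distrib,
      _root_.map_sum, sum_apply, inner_sum]
    refine Finset.sum_congr rfl fun s _ => ?_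
    rw [inner_sum, Finset.mul_sum, ← Finset.sum_sub_distrib, _root_.map_sum, sum_apply, inner_sum]
    refine Finset.sum_congr rfl fun t _ => ?_
    rw [inner_apply_star_mul π (a s), mul_assoc, map_mul, mul_apply_eq_comp, StarHomClass.map_star,
      ← inner_apply_eq_star, map_mul, mul_apply_eq_comp, ← Complex.coe_smul, _root_.map_sub,
      _root_.map_smul, sub_apply, smul_apply, inner_sub_right, inner_smul_right]
  have hm : (1 : ℝ) ≤ ⌊K⌋₊ := by exact_mod_cast Nat.le_floor (by exact_mod_cast hK)
  have hmK : 1 ≤ ⌊K⌋₊ * K := one_le_mul_of_one_le_of_one_le hm hK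
  have hG0 : 0 ≤ G.re := by
    have := (sq_nonneg _).trans h1
    exact nonneg_of_mul_nonneg_right this (by linarith)
  rw [h2, Complex.sub_re, Complex.re_ofReal_mul, Complex.ofReal_re, sub_nonneg]
  exact h1.trans (by gcongr)

include hE in
lemma star_smul_sub (a : A) : star (L • E a - a) = L • E (star a) - star a := by
  rw [star_sub, star_smul, hE.map_star, star_trivial]

include hE in
lemma sum_nonneg (hK : 1 ≤ K) (hpos : ∀ a : A, 0 ≤ a → 0 ≤ K • E a - a) (hL : ⌊K⌋₊ * K ≤ L)
    {ι : Type*} [Fintype ι] (a c : ι → A) :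
    0 ≤ ∑ s, ∑ t, star (c s) * (L • E (star (a s) * a t) - star (a s) * a t) * c t := by
  refine nonneg_of_forall_extreme_state ?_ fun f hf => ?_
  · rw [IsSelfAdjoint, star_sum]
    simp_rw [star_sum, star_mul, hE.star_smul_sub, star_mul, star_star, mul_assoc]
    exact Finset.sum_comm
  · rw [← f.inner_gnsVec_apply]
    exact hE.re_inner_sum_nonneg f.gnsStarAlgHom hK hpos hL
      (commute_eq_smul_one f.denseRange_gns (fun a => (f.inner_gnsVec_apply a).symm) hf) a c _

include hE in
theorem isCompletelyPositive (hK : 1 ≤ K) (hpos : ∀ a : A, 0 ≤ a → 0 ≤ K • E a - a)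
    (hL : ⌊K⌋₊ * K ≤ L) : IsCompletelyPositive fun a : A => L • E a - a := by
  rintro n _ ⟨B, rfl⟩
  refine Matrix.exists_eq_star_mul_self_of_forall_sum_nonneg ?_ fun c => ?_
  · ext i j
    rw [Matrix.star_apply, Matrix.map_apply, Matrix.map_apply, hE.star_smul_sub,
      ← Matrix.star_apply, star_mul, star_star]
  · have h : ∑ s, ∑ t, star (c s) * ((star B * B).map fun a => L • E a - a) s t * c t =
        ∑ k, ∑ s, ∑ t, star (c s) *
          (L • E (star (B k s) * B k t) - star (B k s) * B k t) * c t := by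
      symm
      rw [Finset.sum_comm]
      refine Finset.sum_congr rfl fun s _ => ?_
      rw [Finset.sum_comm]
      refine Finset.sum_congr rfl fun t _ => ?_
      symm
      rw [Matrix.map_apply, Matrix.mul_apply, hE.map_sum, Finset.smul_sum,
        ← Finset.sum_sub_distrib, Finset.mul_sum, Finset.sum_mul]
      rfl
    rw [h]
    exact Finset.sum_nonneg fun k _ => hE.sum_nonneg hK hpos hL (B k) c

end IsCondExp
end Conclusion

end PositiveDomination

theorem condexp_pos_implies_completely_positive
    (E : A → A) (hE : IsCondExp E) (K : ℝ) (hK : 1 ≤ K)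
    (hpos : ∀ a : A, 0 ≤ a → 0 ≤ K • E a - a) :
    ∀ L : ℝ, K * (⌊K⌋ : ℝ) ≤ L →
      IsCompletelyPositive (fun a : A => L • E a - a) := by
  intro L hL
  refine hE.isCompletelyPositive hK hpos ?_
  rwa [natCast_floor_eq_intCast_floor (zero_le_one.trans hK), mul_comm]
end

section
/- Let A be a unital C*-algebra and E a faithful conditional expectation on A with range B. Suppose A is complete with respect to the norm a ↦ ‖E(a* a)‖^{1/2}, i.e. every sequence (a_n) in A with ‖E((a_n − a_m)*(a_n − a_m))‖ → 0 as n, m → ∞ admits a limit a ∈ A with ‖E((a_n − a)*(a_n − a))‖ → 0. Then there exists a real number K ≥ 1 such that the map K·E − id_A is positive. -/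
variable {A : Type*} [CStarAlgebra A] [PartialOrder A] [StarOrderedRing A]

/-- Banach's isomorphism theorem for a complete norm `N` on `Y` given as a plain function: a
linear bijection from a Banach space which is bounded for `N` is bounded below for `N`. -/
lemma exists_norm_le_mul_of_complete_norm {X Y : Type*} [NormedAddCommGroup X]
    [NormedSpace ℂ X] [CompleteSpace X] [AddCommGroup Y] [Module ℂ Y] (N : Y → ℝ)
    (hnonneg : ∀ y, 0 ≤ N y) (hsmul : ∀ (c : ℂ) (y : Y), N (c • y) = ‖c‖ * N y)
    (hadd : ∀ y z, N (y + z) ≤ N y + N z) (hzero : ∀ y, N y = 0 → y = 0)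
    (hcomplete : ∀ u : ℕ → Y,
      (∀ ε : ℝ, 0 < ε → ∃ M : ℕ, ∀ n ≥ M, ∀ m ≥ M, N (u n - u m) < ε) →
      ∃ y : Y, Filter.Tendsto (fun n => N (u n - y)) Filter.atTop (nhds 0))
    (e : X ≃ₗ[ℂ] Y) (C : ℝ) (hC : ∀ x, N (e x) ≤ C * ‖x‖) :
    ∃ D : ℝ, 0 ≤ D ∧ ∀ x, ‖x‖ ≤ D * N (e x) := by
  let : Norm Y := ⟨N⟩
  have core : NormedSpace.Core ℂ Y :=
    { norm_nonneg := hnonneg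
      norm_smul := hsmul
      norm_triangle := hadd
      norm_eq_zero_iff := fun y =>
        ⟨hzero y, by rintro rfl; change N 0 = 0; simpa using hsmul 0 0⟩ }
  let : NormedAddCommGroup Y := NormedAddCommGroup.ofCore core
  let : NormedSpace ℂ Y := NormedSpace.ofCore core
  have hN : ∀ y : Y, ‖y‖ = N y := fun _ => rfl
  have : CompleteSpace Y := by
    refine Metric.complete_of_cauchySeq_tendsto fun u hu => ?_
    rw [Metric.cauchySeq_iff] at hu
    obtain ⟨y, hy⟩ := hcomplete u fun ε hε => by
      simpa only [dist_eq_norm, hN] using hu ε hε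
    refine ⟨y, ?_⟩
    rw [tendsto_iff_norm_sub_tendsto_zero]
    exact hy
  have hcont : Continuous e :=
    AddMonoidHomClass.continuous_of_bound e C hC
  let f := e.toContinuousLinearEquivOfContinuous hcont
  refine ⟨‖(f.symm : Y →L[ℂ] X)‖, norm_nonneg _, fun x => ?_⟩
  simpa [f, hN] using (f.symm : Y →L[ℂ] X).le_opNorm (e x)

namespace IsCondExp

variable {E : A → A}

/-- A conditional expectation as a linear map. -/
def toLinearMap (hE : IsCondExp E) : A →ₗ[ℂ] A where
  toFun := E
  map_add' := hE.map_add
  map_smul' := hE.map_smul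

lemma map_sub (hE : IsCondExp E) (a b : A) : E (a - b) = E a - E b :=
  _root_.map_sub hE.toLinearMap a b

lemma map_real_smul (hE : IsCondExp E) (r : ℝ) (a : A) : E (r • a) = r • E a :=
  LinearMap.map_smul_of_tower hE.toLinearMap r a

lemma monotone (hE : IsCondExp E) {a b : A} (hab : a ≤ b) : E a ≤ E b := by
  rw [← sub_nonneg, ← hE.map_sub]
  exact hE.pos _ (sub_nonneg.2 hab)

lemma continuous (hE : IsCondExp E) : Continuous E :=
  AddMonoidHomClass.continuous_of_bound hE.toLinearMap 1 fun a => by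
    simpa [toLinearMap] using hE.contractive a

/-- The range of a conditional expectation, described as its set of fixed points. -/
def fixedPoints (hE : IsCondExp E) : StarSubalgebra ℂ A where
  carrier := {a | E a = a}
  mul_mem' {a b} ha hb := by
    have h := hE.range_mul a b
    rwa [ha, hb] at h
  add_mem' {a b} ha hb := by
    change E (a + b) = a + b
    rw [hE.map_add, ha, hb]
  algebraMap_mem' c := by
    change E _ = _
    rw [Algebra.algebraMap_eq_smul_one, hE.map_smul, hE.map_one]
  star_mem' {a} ha := by
    have h := hE.range_star a
    rwa [ha] at h

lemma isClosed_fixedPoints (hE : IsCondExp E) : IsClosed (hE.fixedPoints : Set A) :=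
  isClosed_eq hE.continuous continuous_id

lemma rpow_mem_fixedPoints (hE : IsCondExp E) {a : A} (ha : 0 ≤ a) (h : E a = a) (r : ℝ) :
    E (a ^ r) = a ^ r := by
  have : IsClosed (hE.fixedPoints : Set A) := hE.isClosed_fixedPoints
  have hmem : a ^ r ∈ hE.fixedPoints := by
    rw [CFC.rpow_eq_cfc_real ha]
    exact cfc_mem (𝕜 := ℝ) (𝕜' := ℂ) _ (show a ∈ hE.fixedPoints from h)
  exact hmem

/-- The norm `a ↦ ‖E (a* a)‖ ^ (1/2)` satisfies the triangle inequality. -/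
lemma sqrt_norm_add_le (hE : IsCondExp E)
    (hfaith : ∀ a : A, E (star a * a) = 0 → a = 0) (a b : A) :
    √‖E (star (a + b) * (a + b))‖ ≤ √‖E (star a * a)‖ + √‖E (star b * b)‖ := by
  set p := √‖E (star a * a)‖ with hp
  set q := √‖E (star b * b)‖ with hq
  have hp0 : 0 ≤ p := Real.sqrt_nonneg _
  have hq0 : 0 ≤ q := Real.sqrt_nonneg _
  have hpp : ‖E (star a * a)‖ = p ^ 2 := (Real.sq_sqrt (norm_nonneg _)).symm
  have hqq : ‖E (star b * b)‖ = q ^ 2 := (Real.sq_sqrt (norm_nonneg _)).symm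
  rcases hp0.eq_or_lt with hp1 | hp1
  · have : a = 0 := hfaith a <| norm_eq_zero.1 (by rw [hpp, ← hp1]; norm_num)
    simp [this, hp1.symm, hq]
  rcases hq0.eq_or_lt with hq1 | hq1
  · have : b = 0 := hfaith b <| norm_eq_zero.1 (by rw [hqq, ← hq1]; norm_num)
    simp [this, hq1.symm, hp]
  refine Real.sqrt_le_iff.2 ⟨by positivity, ?_⟩
  have key : star (a + b) * (a + b) ≤
      (1 + q / p) • (star a * a) + (1 + p / q) • (star b * b) := by
    have h := star_mul_self_nonneg (√(q / p) • a - √(p / q) • b)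
    have h1 : √(q / p) * √(q / p) = q / p := Real.mul_self_sqrt (by positivity)
    have h2 : √(p / q) * √(p / q) = p / q := Real.mul_self_sqrt (by positivity)
    have h3 : √(q / p) * √(p / q) = 1 := by
      rw [← Real.sqrt_mul (by positivity)]
      field_simp
      simp
    have h4 : star (√(q / p) • a - √(p / q) • b) * (√(q / p) • a - √(p / q) • b) =
        (q / p) • (star a * a) + (p / q) • (star b * b) - (star a * b + star b * a) := by
      simp only [star_sub, star_smul, star_trivial, sub_mul, mul_sub, smul_mul_assoc,
        mul_smul_comm, smul_sub, smul_smul, h1, h2, h3, mul_comm √(p / q) √(q / p), one_smul]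
      abel
    rw [h4] at h
    rw [← sub_nonneg]
    convert h using 1
    simp only [star_add, add_mul, mul_add, add_smul, one_smul]
    abel
  calc ‖E (star (a + b) * (a + b))‖
      ≤ ‖E ((1 + q / p) • (star a * a) + (1 + p / q) • (star b * b))‖ :=
        CStarAlgebra.norm_le_norm_of_nonneg_of_le (hE.pos _ (star_mul_self_nonneg _))
          (hE.monotone key)
    _ ≤ (1 + q / p) * p ^ 2 + (1 + p / q) * q ^ 2 := by
        rw [hE.map_add, hE.map_real_smul, hE.map_real_smul]
        refine (norm_add_le _ _).trans_eq ?_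
        rw [norm_smul, norm_smul, hpp, hqq, Real.norm_of_nonneg (by positivity),
          Real.norm_of_nonneg (by positivity)]
    _ = (p + q) ^ 2 := by
        field_simp
        ring

/-- A bound of the norm by the norm `a ↦ ‖E (a* a)‖ ^ (1/2)` upgrades to an operator
inequality, since one may normalize by elements of the range of `E`. -/
lemma star_mul_self_le (hE : IsCondExp E) {C : ℝ} (hC0 : 0 ≤ C)
    (hC : ∀ a : A, ‖a‖ ^ 2 ≤ C * ‖E (star a * a)‖) (x : A) :
    star x * x ≤ C • E (star x * x) := by
  nontriviality A
  have main : ∀ ε : ℝ, 0 < ε → star x * x ≤ C • (E (star x * x) + algebraMap ℝ A ε) := by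
    intro ε hε
    set h := E (star x * x) + algebraMap ℝ A ε with hh
    have hEx : 0 ≤ E (star x * x) := hE.pos _ (star_mul_self_nonneg _)
    have hpos : IsStrictlyPositive h :=
      IsStrictlyPositive.nonneg_add hEx (isStrictlyPositive_algebraMap hε)
    have hfix : E h = h := by
      rw [hh, hE.map_add, hE.idem, Algebra.algebraMap_eq_smul_one, hE.map_real_smul, hE.map_one]
    set b := h ^ (-(1 / 2) : ℝ) with hb
    set s := h ^ (1 / 2 : ℝ) with hs
    have hEb : E b = b := hE.rpow_mem_fixedPoints hpos.nonneg hfix _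
    have hbsa : star b = b := (CFC.rpow_nonneg (a := h)).isSelfAdjoint
    have hssa : star s = s := (CFC.rpow_nonneg (a := h)).isSelfAdjoint
    have hbs : b * s = 1 := CFC.rpow_neg_mul_rpow _ hpos
    have hsb : s * b = 1 := CFC.rpow_mul_rpow_neg _ hpos
    have hss : s * s = h := by
      rw [hs, ← CFC.rpow_add hpos.isUnit]
      norm_num
      exact CFC.rpow_one h hpos.nonneg
    have hbhb : b * h * b = 1 := by
      rw [← hss, ← mul_assoc, hbs, one_mul, hsb]
    have hE1 : E (star (x * b) * (x * b)) ≤ 1 := by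
      have h1 : star (x * b) * (x * b) = E b * (star x * x) * E b := by
        rw [hEb, star_mul, hbsa]
        simp only [mul_assoc]
      rw [h1, hE.bimod, hEb, ← hbhb]
      have h2 : E (star x * x) ≤ h := by
        rw [hh]
        exact le_add_of_nonneg_right (isStrictlyPositive_algebraMap hε).nonneg
      simpa only [hbsa] using star_left_conjugate_le_conjugate h2 b
    have hnorm : ‖E (star (x * b) * (x * b))‖ ≤ 1 := by
      simpa using CStarAlgebra.norm_le_norm_of_nonneg_of_le
        (hE.pos _ (star_mul_self_nonneg (x * b))) hE1
    have hle : star (x * b) * (x * b) ≤ algebraMap ℝ A C :=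
      CStarAlgebra.star_mul_le_algebraMap_norm_sq.trans <| algebraMap_mono A <|
        (hC _).trans (mul_le_of_le_one_right hC0 hnorm)
    have hconj := star_left_conjugate_le_conjugate hle s
    have hl : star s * (star (x * b) * (x * b)) * s = star x * x := by
      rw [star_mul, hbsa, hssa]
      calc s * (b * star x * (x * b)) * s = (s * b) * (star x * x) * (b * s) := by
            simp only [mul_assoc]
        _ = star x * x := by rw [hsb, hbs, one_mul, mul_one]
    rwa [hl, hssa, Algebra.algebraMap_eq_smul_one, mul_smul_comm, mul_one, smul_mul_assoc,
      hss] at hconj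
  have hlim : Filter.Tendsto (fun ε : ℝ => C • (E (star x * x) + algebraMap ℝ A ε))
      (nhdsWithin 0 (Set.Ioi 0)) (nhds (C • E (star x * x))) := by
    have hc : Continuous fun ε : ℝ => C • (E (star x * x) + algebraMap ℝ A ε) := by
      have := continuous_algebraMap ℝ A
      fun_prop
    simpa using (hc.tendsto 0).mono_left nhdsWithin_le_nhds
  exact ge_of_tendsto hlim (Filter.eventually_of_mem self_mem_nhdsWithin main)

end IsCondExp

theorem condexp_complete_implies_pos
    (E : A → A) (hE : IsCondExp E)
    (hfaith : ∀ a : A, E (star a * a) = 0 → a = 0)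
    (hcomplete : ∀ u : ℕ → A,
      (∀ ε : ℝ, 0 < ε → ∃ N : ℕ, ∀ n ≥ N, ∀ m ≥ N,
        ‖E (star (u n - u m) * (u n - u m))‖ < ε) →
      ∃ a : A, Filter.Tendsto (fun n => ‖E (star (u n - a) * (u n - a))‖)
        Filter.atTop (nhds 0)) :
    ∃ K : ℝ, 1 ≤ K ∧ ∀ a : A, 0 ≤ a → 0 ≤ K • E a - a := by
  obtain ⟨D, hD0, hD⟩ := exists_norm_le_mul_of_complete_norm (X := A) (Y := A)
    (fun a => √‖E (star a * a)‖) (fun _ => Real.sqrt_nonneg _)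
    (fun c a => by
      have : star (c • a) * (c • a) = (star c * c) • (star a * a) := by
        rw [star_smul, smul_mul_smul_comm]
      simp only [this, hE.map_smul, norm_smul, CStarRing.norm_star_mul_self]
      rw [Real.sqrt_mul (by positivity), Real.sqrt_mul_self (norm_nonneg c)])
    (hE.sqrt_norm_add_le hfaith)
    (fun a ha => hfaith a <| norm_eq_zero.1 <| (Real.sqrt_eq_zero (norm_nonneg _)).1 ha)
    (fun u hu => by
      obtain ⟨a, ha⟩ := hcomplete u fun ε hε => by
        obtain ⟨M, hM⟩ := hu (√ε) (Real.sqrt_pos.2 hε)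
        exact ⟨M, fun n hn m hm => (Real.sqrt_lt_sqrt_iff (norm_nonneg _)).1 (hM n hn m hm)⟩
      exact ⟨a, by simpa using ha.sqrt⟩)
    (LinearEquiv.refl ℂ A) 1
    (fun a => by
      refine Real.sqrt_le_iff.2 ⟨by positivity, (hE.contractive _).trans_eq ?_⟩
      rw [CStarRing.norm_star_mul_self, one_mul, sq]
      rfl)
  have hC : ∀ a : A, ‖a‖ ^ 2 ≤ D ^ 2 * ‖E (star a * a)‖ := fun a => by
    have h := pow_le_pow_left₀ (norm_nonneg a) (hD a) 2
    rwa [mul_pow, Real.sq_sqrt (norm_nonneg _)] at h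
  refine ⟨max 1 (D ^ 2), le_max_left _ _, fun a ha => ?_⟩
  obtain ⟨x, rfl⟩ := CStarAlgebra.nonneg_iff_eq_star_mul_self.1 ha
  rw [sub_nonneg]
  exact (hE.star_mul_self_le (sq_nonneg D) hC x).trans
    (smul_le_smul_of_nonneg_right (le_max_right _ _) (hE.pos _ ha))
end
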